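/- arXiv:1302.3678 — 13 statements merged into one kernel-verified Lean document; each statement's English description precedes it below -/
import Mathlib

section
/- Let p be a prime with p > 3. Then (-1)^((p-1)/2) · C(p-1, (p-1)/2) ≡ 2^(2p-2) (mod p^3), where C(p-1, (p-1)/2) denotes the central binomial coefficient choose(p-1, (p-1)/2). -/
open Finset

/-- If `x ^ 3 = 0` then `∏ (1 + x ^ 2 * c j) = 1 + x ^ 2 * ∑ c j`. -/
lemma prod_one_add_sq_mul {R : Type*} [CommRing R] {x : R} (hx : x ^ 3 = 0) (c : ℕ → R) (n : ℕ) :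
    ∏ j ∈ range n, (1 + x ^ 2 * c j) = 1 + x ^ 2 * ∑ j ∈ range n, c j := by
  induction n with
  | zero => simp
  | succ n ih =>
    rw [prod_range_succ, ih, sum_range_succ]
    linear_combination x * (∑ j ∈ range n, c j) * c n * hx

lemma centralBinom_mul_prod_even (k : ℕ) :
    k.centralBinom * ∏ j ∈ range k, (2 * (j + 1)) = 4 ^ k * ∏ j ∈ range k, (2 * j + 1) := by
  induction k with
  | zero => simp
  | succ k ih =>
    have h := Nat.succ_mul_centralBinom_succ k
    rw [prod_range_succ, prod_range_succ, pow_succ]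
    linear_combination 2 * (∏ j ∈ range k, (2 * (j + 1))) * h + 4 * (2 * k + 1) * ih

/-- The sum of the inverse squares of `1, …, (p - 1) / 2` vanishes modulo `p`. -/
lemma sum_inv_sq_half_eq_zero {p m : ℕ} [Fact p.Prime] (hp3 : 3 < p) (hm : p = 2 * m + 1) :
    ∑ j ∈ range m, (((j + 1 : ℕ) : ZMod p)⁻¹) ^ 2 = 0 := by
  have hall : ∑ x : ZMod p, x⁻¹ ^ 2 = 0 := by
    have h2 : ∑ x : ZMod p, x ^ 2 = 0 :=
      FiniteField.sum_pow_lt_card_sub_one (ZMod p) 2 (by rw [ZMod.card]; omega)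
    rw [← h2]
    exact Equiv.sum_comp (Equiv.inv (ZMod p)) (fun x => x ^ 2)
  have hrange : ∑ x : ZMod p, x⁻¹ ^ 2 = ∑ j ∈ range p, ((j : ZMod p)⁻¹) ^ 2 := by
    symm
    refine sum_bij (fun j _ => (j : ZMod p)) (fun _ _ => mem_univ _) ?_ ?_ (fun _ _ => rfl)
    · intro a ha b hb hab
      rw [ZMod.natCast_eq_natCast_iff'] at hab
      rwa [Nat.mod_eq_of_lt (mem_range.1 ha), Nat.mod_eq_of_lt (mem_range.1 hb)] at hab
    · intro b _
      exact ⟨b.val, by simpa using b.val_lt, by simp⟩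
  have hsplit : ∑ j ∈ range p, ((j : ZMod p)⁻¹) ^ 2
      = 2 * ∑ j ∈ range m, (((j + 1 : ℕ) : ZMod p)⁻¹) ^ 2 := by
    conv_lhs => rw [show range p = range (m + m + 1) by rw [hm, two_mul]]
    rw [sum_range_succ', sum_range_add, two_mul]
    simp only [Nat.cast_zero, inv_zero, ne_eq, OfNat.ofNat_ne_zero, not_false_eq_true, zero_pow,
      add_zero]
    congr 1
    rw [← sum_range_reflect]
    refine sum_congr rfl fun j hj => ?_
    have hj' := mem_range.1 hj
    have : ((m + (m - 1 - j) + 1 : ℕ) : ZMod p) = -((j + 1 : ℕ) : ZMod p) := by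
      rw [eq_neg_iff_add_eq_zero, ← Nat.cast_add,
        show m + (m - 1 - j) + 1 + (j + 1) = p by omega, ZMod.natCast_self]
    rw [this, inv_neg, neg_sq]
  have htwo : (2 : ZMod p) ≠ 0 := by
    intro h
    have := Nat.le_of_dvd two_pos ((ZMod.natCast_eq_zero_iff 2 p).1 (by exact_mod_cast h))
    omega
  rw [hrange, hsplit] at hall
  exact (mul_eq_zero.1 hall).resolve_left htwo

/-- The product expansion of `(-1) ^ k * choose (p - 1) k`, given inverses `u j` of `j + 1`. -/
lemma neg_one_pow_mul_choose_eq_prod {R : Type*} [CommRing R] {n : ℕ} (u : ℕ → R) {k : ℕ}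
    (hu : ∀ j < k, ((j + 1 : ℕ) : R) * u j = 1) (hk : k ≤ n) :
    (-1) ^ k * (n.choose k : R) = ∏ j ∈ range k, (1 - ((n + 1 : ℕ) : R) * u j) := by
  induction k with
  | zero => simp
  | succ k ih =>
    rw [prod_range_succ, ← ih (fun j hj => hu j (by omega)) (by omega)]
    have h : (n.choose (k + 1) : R) * (k + 1) = n.choose k * (n - k) := by
      have := congrArg (Nat.cast (R := R)) (Nat.choose_succ_right_eq n k)
      rw [Nat.cast_mul, Nat.cast_mul, Nat.cast_sub (by omega)] at this
      exact_mod_cast this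
    have h1 := hu k (by omega)
    push_cast at h1 ⊢
    rw [pow_succ]
    linear_combination (-(-1) ^ k * u k) * h +
      (-1) ^ k * (n.choose (k + 1) + n.choose k : R) * h1

theorem morley_congruence (p : ℕ) (hp : p.Prime) (hp3 : 3 < p) :
    ((-1 : ZMod (p ^ 3)) ^ ((p - 1) / 2) * (Nat.choose (p - 1) ((p - 1) / 2) : ZMod (p ^ 3)))
      = 2 ^ (2 * p - 2) := by
  have : Fact p.Prime := ⟨hp⟩
  obtain ⟨m, hm⟩ := hp.odd_of_ne_two (by omega)
  rw [show (p - 1) / 2 = m by omega, show p - 1 = 2 * m by omega,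
    show 2 * p - 2 = 2 * m + 2 * m by omega]
  have hp0 : (p : ZMod (p ^ 3)) ^ 3 = 0 := by
    rw [← Nat.cast_pow]; exact ZMod.natCast_self _
  have hinv : ∀ k : ℕ, 0 < k → k < p → (k : ZMod (p ^ 3)) * (k : ZMod (p ^ 3))⁻¹ = 1 :=
    fun k h0 hk => ZMod.coe_mul_inv_eq_one k
      ((Nat.coprime_of_lt_prime (by omega) hk hp).symm.pow_right 3)
  set u : ℕ → ZMod (p ^ 3) := fun j => ((j + 1 : ℕ) : ZMod (p ^ 3))⁻¹
  have hu : ∀ j < m, ((j + 1 : ℕ) : ZMod (p ^ 3)) * u j = 1 :=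
    fun j hj => hinv _ (by omega) (by omega)
  obtain ⟨h, hh⟩ : ∃ h : ZMod (p ^ 3), 2 * h = 1 :=
    ⟨_, by exact_mod_cast hinv 2 (by omega) (by omega)⟩
  have hA := neg_one_pow_mul_choose_eq_prod (n := 2 * m) u hu (by omega)
  rw [← hm] at hA
  set A : ZMod (p ^ 3) := (-1) ^ m * ((2 * m).choose m : ZMod (p ^ 3))
  set Q : ZMod (p ^ 3) := ∏ j ∈ range m, (1 - (p : ZMod (p ^ 3)) * (u j * h))
  have hS : (p : ZMod (p ^ 3)) ^ 2 * ∑ j ∈ range m, (u j * h) ^ 2 = 0 := by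
    have hcast : ZMod.castHom (dvd_pow_self p three_ne_zero) (ZMod p)
        (∑ j ∈ range m, (u j) ^ 2) = 0 := by
      rw [map_sum, ← sum_inv_sq_half_eq_zero hp3 hm]
      refine sum_congr rfl fun j hj => ?_
      rw [map_pow]
      congr 1
      refine eq_inv_of_mul_eq_one_right ?_
      have := congrArg (ZMod.castHom (dvd_pow_self p three_ne_zero) (ZMod p))
        (hu j (mem_range.1 hj))
      rwa [map_mul, map_natCast, map_one] at this
    obtain ⟨x, hx⟩ : (p : ZMod (p ^ 3)) ∣ ∑ j ∈ range m, (u j) ^ 2 := by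
      have : NeZero (p ^ 3) := ⟨pow_ne_zero 3 hp.ne_zero⟩
      rw [← ZMod.natCast_zmod_val (∑ j ∈ range m, (u j) ^ 2)] at hcast ⊢
      rw [map_natCast, ZMod.natCast_eq_zero_iff] at hcast
      exact Nat.cast_dvd_cast hcast
    simp_rw [mul_pow]
    rw [← sum_mul, hx]
    linear_combination x * h ^ 2 * hp0
  have hQsq : Q ^ 2 = A := by
    have : Q ^ 2 = A * ∏ j ∈ range m, (1 + (p : ZMod (p ^ 3)) ^ 2 * (u j * h) ^ 2) := by
      rw [hA, ← prod_mul_distrib, ← prod_pow]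
      refine prod_congr rfl fun j _ => ?_
      linear_combination (u j) ^ 3 * h ^ 2 * hp0 - p * u j * hh
    rw [this, prod_one_add_sq_mul hp0, hS, add_zero, mul_one]
  have hQunit : IsUnit Q := by
    refine IsUnit.prod_iff.2 fun j _ => ?_
    refine IsUnit.of_mul_eq_one (1 + p * (u j * h) + (p * (u j * h)) ^ 2) ?_
    linear_combination -(u j * h) ^ 3 * hp0
  have hAQ : A = 2 ^ (2 * m) * Q := by
    have hD : IsUnit (∏ j ∈ range m, (2 * ((j : ZMod (p ^ 3)) + 1))) := by
      refine IsUnit.prod_iff.2 fun j hj => ?_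
      have := hu j (mem_range.1 hj)
      push_cast at this
      refine IsUnit.of_mul_eq_one (u j * h) ?_
      linear_combination 2 * h * this + hh
    have hDQ : (∏ j ∈ range m, (2 * ((j : ZMod (p ^ 3)) + 1))) * Q
        = (-1) ^ m * ∏ j ∈ range m, (2 * (j : ZMod (p ^ 3)) + 1) := by
      rw [← prod_range_reflect (fun j => 2 * (j : ZMod (p ^ 3)) + 1), ← prod_mul_distrib]
      have hsign : (-1 : ZMod (p ^ 3)) ^ m = ∏ _j ∈ range m, (-1) := by simp
      rw [hsign, ← prod_mul_distrib]
      refine prod_congr rfl fun j hj => ?_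
      have hj' := mem_range.1 hj
      have h1 := hu j hj'
      have h2 : ((m - 1 - j : ℕ) : ZMod (p ^ 3)) + (j + 1) = m := by
        exact_mod_cast congrArg (Nat.cast (R := ZMod (p ^ 3)))
          (show m - 1 - j + (j + 1) = m by omega)
      have h3 : (p : ZMod (p ^ 3)) = 2 * m + 1 := by
        exact_mod_cast congrArg (Nat.cast (R := ZMod (p ^ 3))) hm
      push_cast at h1
      linear_combination -2 * h * p * h1 - p * hh + 2 * h2 - h3
    have hC := congrArg (Nat.cast (R := ZMod (p ^ 3))) (centralBinom_mul_prod_even m)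
    rw [Nat.centralBinom_eq_two_mul_choose] at hC
    push_cast at hC
    refine hD.mul_left_cancel ?_
    rw [pow_mul, show (2 : ZMod (p ^ 3)) ^ 2 = 4 by norm_num]
    linear_combination (-1) ^ m * hC - 4 ^ m * hDQ
  have hQ : Q = 2 ^ (2 * m) := hQunit.mul_right_cancel (by rw [← sq, hQsq, hAQ])
  rw [hAQ, hQ, pow_add]
end

section
/- Let p be a prime with p > 3. Then (-1)^((p-1)/2) · C(p-1, (p-1)/2) ≡ 2^(2p-2) (mod p^2), where C(p-1, (p-1)/2) denotes the central binomial coefficient choose(p-1, (p-1)/2). -/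
theorem alternating_sum_range_choose_succ (N n : ℕ) :
    ∑ j ∈ Finset.range (n + 1), (-1 : ℤ) ^ j * ((N + 1).choose j : ℤ) =
      (-1) ^ n * (N.choose n : ℤ) := by
  induction n with
  | zero => simp
  | succ n ih =>
    rw [Finset.sum_range_succ, ih, Nat.choose_succ_succ]
    push_cast
    ring

theorem sum_range_choose_two_mul (N n : ℕ) :
    ∑ j ∈ Finset.range (n + 1), (N + 1).choose (2 * j) =
      ∑ i ∈ Finset.range (2 * n + 1), N.choose i := by
  induction n with
  | zero => simp
  | succ n ih =>
    rw [Finset.sum_range_succ, ih, show 2 * (n + 1) = 2 * n + 1 + 1 by ring,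
      Finset.sum_range_succ _ (2 * n + 1 + 1), Finset.sum_range_succ _ (2 * n + 1),
      Nat.choose_succ_succ, add_assoc]

theorem Nat.Prime.dvd_neg_one_pow_mul_choose_sub_one {N : ℕ} (hp : (N + 1).Prime) {k : ℕ}
    (hk : k ≤ N) : ((N + 1 : ℕ) : ℤ) ∣ (-1) ^ k * (N.choose k : ℤ) - 1 := by
  rw [← alternating_sum_range_choose_succ, Finset.sum_range_succ']
  simp only [pow_zero, Nat.choose_zero_right, Nat.cast_one, mul_one, add_sub_cancel_right]
  refine Finset.dvd_sum fun j hj => Dvd.dvd.mul_left ?_ _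
  rw [Finset.mem_range] at hj
  exact Int.natCast_dvd_natCast.mpr (hp.dvd_choose_self (by omega) (by omega))

theorem Nat.Prime.sq_dvd_mul_neg_one_pow_mul_choose {N : ℕ} (hp : (N + 1).Prime) {k : ℕ}
    (hk : 0 < k) (hkN : k ≤ N) :
    ((N + 1 : ℕ) : ℤ) ^ 2 ∣ k * ((-1) ^ k * ((N + 1).choose k : ℤ)) + ((N + 1 : ℕ) : ℤ) := by
  obtain ⟨i, rfl⟩ : ∃ i, k = i + 1 := ⟨k - 1, by omega⟩
  obtain ⟨c, hc⟩ := hp.dvd_neg_one_pow_mul_choose_sub_one (show i ≤ N by omega)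
  have h : ((N + 1 : ℕ) : ℤ) * (N.choose i : ℤ) =
      ((N + 1).choose (i + 1) : ℤ) * ((i + 1 : ℕ) : ℤ) := by
    exact_mod_cast Nat.add_one_mul_choose_eq N i
  refine ⟨-c, ?_⟩
  rw [pow_succ (-1 : ℤ)]
  linear_combination (-1 : ℤ) ^ i * h - ((N + 1 : ℕ) : ℤ) * hc

theorem Nat.Prime.sq_dvd_neg_one_pow_mul_choose_sub {N : ℕ} (hp : (N + 1).Prime) {j : ℕ}
    (hj : 0 < j) (hjN : 2 * j ≤ N) :
    ((N + 1 : ℕ) : ℤ) ^ 2 ∣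
      (-1) ^ j * ((N + 1).choose j : ℤ) - 2 * ((N + 1).choose (2 * j) : ℤ) := by
  have h₁ := hp.sq_dvd_mul_neg_one_pow_mul_choose hj (by omega)
  have h₂ := hp.sq_dvd_mul_neg_one_pow_mul_choose (k := 2 * j) (by omega) hjN
  have h := _root_.dvd_sub h₁ h₂
  have hco : IsCoprime (((N + 1 : ℕ) : ℤ) ^ 2) (j : ℤ) :=
    (Nat.isCoprime_iff_coprime.mpr
      (Nat.coprime_of_lt_prime (by omega) (by omega) hp)).pow_left
  refine hco.dvd_of_dvd_mul_left ?_
  convert h using 1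
  rw [pow_mul]
  push_cast
  ring

theorem Nat.Prime.sq_dvd_neg_one_pow_mul_centralBinom_sub {m : ℕ} (hp : (2 * m + 1).Prime) :
    ((2 * m + 1 : ℕ) : ℤ) ^ 2 ∣ (-1) ^ m * ((2 * m).choose m : ℤ) - (2 * 2 ^ (2 * m) - 1) := by
  have hB : ∑ j ∈ Finset.range (m + 1), ((2 * m + 1).choose (2 * j) : ℤ) = 2 ^ (2 * m) := by
    exact_mod_cast (sum_range_choose_two_mul (2 * m) m).trans (Nat.sum_range_choose _)
  rw [← alternating_sum_range_choose_succ, ← hB, Finset.sum_range_succ', Finset.sum_range_succ']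
  have h : ((2 * m + 1 : ℕ) : ℤ) ^ 2 ∣ ∑ j ∈ Finset.range m,
      ((-1) ^ (j + 1) * ((2 * m + 1).choose (j + 1) : ℤ) -
        2 * ((2 * m + 1).choose (2 * (j + 1)) : ℤ)) := by
    refine Finset.dvd_sum fun j hj => ?_
    rw [Finset.mem_range] at hj
    exact hp.sq_dvd_neg_one_pow_mul_choose_sub (by omega) (by omega)
  rw [Finset.sum_sub_distrib, ← Finset.mul_sum] at h
  convert h using 1
  simp only [pow_zero, mul_zero, Nat.choose_zero_right, Nat.cast_one]
  ring

theorem morley_congruence_mod_sq (p : ℕ) (hp : p.Prime) (hp3 : 3 < p) :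
    ((-1 : ZMod (p ^ 2)) ^ ((p - 1) / 2) * (Nat.choose (p - 1) ((p - 1) / 2) : ZMod (p ^ 2)))
      = 2 ^ (2 * p - 2) := by
  obtain ⟨m, rfl⟩ : ∃ m, p = 2 * m + 1 := hp.odd_of_ne_two (by omega)
  have hfermat : ((2 * m + 1 : ℕ) : ℤ) ∣ 2 ^ (2 * m) - 1 := by
    have hco : IsCoprime (2 : ℤ) ((2 * m + 1 : ℕ) : ℤ) := ⟨-m, 1, by push_cast; ring⟩
    simpa using (Int.ModEq.pow_card_sub_one_eq_one hp hco).symm.dvd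
  have h := dvd_sub hp.sq_dvd_neg_one_pow_mul_centralBinom_sub (pow_dvd_pow_of_dvd hfermat 2)
  have hz : (((2 * m + 1) ^ 2 : ℕ) : ℤ) ∣
      (-1 : ℤ) ^ m * ((2 * m).choose m : ℤ) - 2 ^ (2 * (2 * m)) := by
    rw [Nat.cast_pow]
    refine h.trans (dvd_of_eq ?_)
    ring
  rw [← ZMod.intCast_zmod_eq_zero_iff_dvd] at hz
  rw [show (2 * m + 1 - 1) / 2 = m by omega, show 2 * m + 1 - 1 = 2 * m by omega,
    show 2 * (2 * m + 1) - 2 = 2 * (2 * m) by omega, ← sub_eq_zero]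
  exact_mod_cast hz
end

section
/- Let p be a prime with p > 3. Then the sum, over all pairs (i, j) with 0 < i < j < p, i odd, and j even, of the product of the multiplicative inverses of i and j modulo p, is congruent to 0 modulo p. -/
/-- A sum over pairs `i < j < p` with `i` odd and `j` even, rewritten in terms of pairs `(i, k)` of
odd numbers with `i + k < p`, where `j = i + k`. -/
theorem sum_odd_lt_even_eq_sum_add {M : Type*} [AddCommMonoid M] (p : ℕ) (f : ℕ → ℕ → M) :
    ∑ j ∈ (Finset.Ico 1 p).filter (fun j => Even j),
      ∑ i ∈ (Finset.Ico 1 j).filter (fun i => Odd i), f i j =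
    ∑ x ∈ (Finset.range p ×ˢ Finset.range p).filter
      (fun x => Odd x.1 ∧ Odd x.2 ∧ x.1 + x.2 < p), f x.1 (x.1 + x.2) := by
  rw [Finset.sum_sigma']
  refine Finset.sum_bij' (fun x _ => (x.2, x.1 - x.2)) (fun x _ => ⟨x.1 + x.2, x.1⟩) ?_ ?_ ?_ ?_ ?_
  all_goals
    simp only [Finset.mem_sigma, Finset.mem_filter, Finset.mem_Ico, Finset.mem_product,
      Finset.mem_range, Nat.odd_iff, Nat.even_iff]
  · rintro ⟨j, i⟩ h; dsimp only at h ⊢; omega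
  · rintro ⟨i, k⟩ h; dsimp only at h ⊢; omega
  · rintro ⟨j, i⟩ h; dsimp only at h ⊢
    rw [Nat.add_sub_cancel' (by omega)]
  · rintro ⟨i, k⟩ h; simp
  · rintro ⟨j, i⟩ h; dsimp only at h ⊢
    rw [Nat.add_sub_cancel' (by omega)]

/-- For odd `p`, a sum over pairs `i < j < p` with `i` odd and `j` even, rewritten in terms of pairs
`(i, k)` of odd numbers with `i + k < p`, where `j = p - k`. -/
theorem sum_odd_lt_even_eq_sum_sub {M : Type*} [AddCommMonoid M] {p : ℕ} (hp : Odd p)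
    (f : ℕ → ℕ → M) :
    ∑ j ∈ (Finset.Ico 1 p).filter (fun j => Even j),
      ∑ i ∈ (Finset.Ico 1 j).filter (fun i => Odd i), f i j =
    ∑ x ∈ (Finset.range p ×ˢ Finset.range p).filter
      (fun x => Odd x.1 ∧ Odd x.2 ∧ x.1 + x.2 < p), f x.1 (p - x.2) := by
  rw [Nat.odd_iff] at hp
  rw [Finset.sum_sigma']
  refine Finset.sum_bij' (fun x _ => (x.2, p - x.1)) (fun x _ => ⟨p - x.2, x.1⟩) ?_ ?_ ?_ ?_ ?_
  all_goals
    simp only [Finset.mem_sigma, Finset.mem_filter, Finset.mem_Ico, Finset.mem_product,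
      Finset.mem_range, Nat.odd_iff, Nat.even_iff]
  · rintro ⟨j, i⟩ h; dsimp only at h ⊢; omega
  · rintro ⟨i, k⟩ h; dsimp only at h ⊢; omega
  · rintro ⟨j, i⟩ h; dsimp only at h ⊢
    rw [Nat.sub_sub_self (by omega)]
  · rintro ⟨i, k⟩ h; dsimp only at h ⊢
    rw [Nat.sub_sub_self (by omega)]
  · rintro ⟨j, i⟩ h; dsimp only at h ⊢
    rw [Nat.sub_sub_self (by omega)]

theorem key_lemma (p : ℕ) (hp : p.Prime) (hp3 : 3 < p) :
    ∑ j ∈ (Finset.Ico 1 p).filter (fun j => Even j),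
      ∑ i ∈ (Finset.Ico 1 j).filter (fun i => Odd i),
        ((i * j : ℕ) : ZMod p)⁻¹ = 0 := by
  have : Fact p.Prime := ⟨hp⟩
  have ne_zero {n : ℕ} (h0 : 0 < n) (hn : n < p) : (n : ZMod p) ≠ 0 := by
    rw [Ne, ZMod.natCast_eq_zero_iff]
    exact Nat.not_dvd_of_pos_of_lt h0 hn
  have three_ne : (3 : ZMod p) ≠ 0 := mod_cast ne_zero three_pos hp3
  have hadd := sum_odd_lt_even_eq_sum_add p fun i j => ((i * j : ℕ) : ZMod p)⁻¹
  have hsub := sum_odd_lt_even_eq_sum_sub (hp.odd_of_ne_two (by omega))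
    fun i j => ((i * j : ℕ) : ZMod p)⁻¹
  set S := ∑ j ∈ (Finset.Ico 1 p).filter (fun j => Even j),
    ∑ i ∈ (Finset.Ico 1 j).filter (fun i => Odd i), ((i * j : ℕ) : ZMod p)⁻¹
  set B := (Finset.range p ×ˢ Finset.range p).filter
    (fun x => Odd x.1 ∧ Odd x.2 ∧ x.1 + x.2 < p) with hB
  have hswap : S = ∑ x ∈ B, ((x.2 * (x.1 + x.2) : ℕ) : ZMod p)⁻¹ := by
    rw [hadd]
    refine Finset.sum_equiv (Equiv.prodComm ℕ ℕ) ?_ ?_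
    · rintro ⟨i, k⟩
      simp only [hB, Finset.mem_filter, Finset.mem_product, Finset.mem_range,
        Equiv.prodComm_apply, Prod.swap_prod_mk, add_comm k i]
      tauto
    · rintro ⟨i, k⟩ _
      simp [add_comm k i]
  have hsum : S + S + S = 0 := by
    nth_rewrite 1 [hadd]
    nth_rewrite 1 [hswap]
    rw [hsub, ← Finset.sum_add_distrib, ← Finset.sum_add_distrib]
    refine Finset.sum_eq_zero ?_
    rintro ⟨i, k⟩ hx
    simp only [hB, Finset.mem_filter, Finset.mem_product, Finset.mem_range] at hx
    obtain ⟨⟨hi, hk⟩, hi_odd, hk_odd, hik⟩ := hx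
    have hi0 := ne_zero hi_odd.pos hi
    have hk0 := ne_zero hk_odd.pos hk
    have hik0 := ne_zero (Nat.add_pos_left hi_odd.pos k) hik
    push_cast [Nat.cast_sub hk.le] at hik0 ⊢
    rw [ZMod.natCast_self, zero_sub]
    field_simp
    ring
  exact (mul_eq_zero.mp (by linear_combination hsum : (3 : ZMod p) * S = 0)).resolve_left three_ne
end

section
/- Let p be a prime with p > 3. Then the sum over i from 1 to p-1 of (-1)^i times the multiplicative inverse of i modulo p^2 is congruent, modulo p^2, to the sum over i from 1 to (p-1)/2 of the multiplicative inverse of i modulo p^2. -/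
/-- An alternating sum of even length plus the plain sum is twice the sum over the even indices. -/
theorem sum_Icc_neg_one_pow_mul_add_sum {R : Type*} [CommRing R] (f : ℕ → R) (m : ℕ) :
    ∑ i ∈ Finset.Icc 1 (2 * m), (-1) ^ i * f i + ∑ i ∈ Finset.Icc 1 (2 * m), f i
      = ∑ i ∈ Finset.Icc 1 m, 2 * f (2 * i) := by
  induction m with
  | zero => simp
  | succ m ih =>
    rw [Finset.sum_Icc_succ_top (by lia : 1 ≤ m + 1), ← ih, show 2 * (m + 1) = 2 * m + 1 + 1 by ring]
    simp only [Finset.sum_Icc_succ_top (Nat.le_add_left 1 _), pow_succ, pow_mul]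
    ring

theorem sum_Icc_natCast_inv_sq_eq_zero (p : ℕ) [Fact p.Prime] (hp3 : 3 < p) :
    ∑ i ∈ Finset.Icc 1 (p - 1), ((i : ZMod p)⁻¹) ^ 2 = 0 := by
  have h_univ : ∑ x : ZMod p, (x⁻¹) ^ 2 = 0 := by
    refine (Equiv.sum_comp (Equiv.inv (ZMod p)) fun x => x ^ 2).trans ?_
    have h_ne : p ≠ 4 := fun h => absurd (Fact.out : p.Prime) (h ▸ by norm_num)
    exact FiniteField.sum_pow_lt_card_sub_one _ 2 (by rw [ZMod.card]; lia)
  rw [← h_univ, ← Finset.sum_erase Finset.univ (a := (0 : ZMod p)) (by simp)]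
  refine Finset.sum_bij' (fun i _ => (i : ZMod p)) (fun x _ => x.val) ?_ ?_ ?_ ?_ ?_
  · intro i hi
    rw [Finset.mem_Icc] at hi
    simp only [Finset.mem_erase, Finset.mem_univ, and_true, ne_eq, ZMod.natCast_eq_zero_iff]
    exact Nat.not_dvd_of_pos_of_lt hi.1 (by lia)
  · intro x hx
    have h_pos : x.val ≠ 0 := by simpa using hx
    have h_lt := x.val_lt
    rw [Finset.mem_Icc]
    lia
  · intro i hi
    rw [Finset.mem_Icc] at hi
    exact ZMod.val_cast_of_lt (by lia)
  · simp
  · simp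

theorem natCast_mul_eq_zero_of_castHom_eq_zero {p : ℕ} [NeZero p] {x : ZMod (p ^ 2)}
    (hx : ZMod.castHom (dvd_pow_self p two_ne_zero) (ZMod p) x = 0) :
    (p : ZMod (p ^ 2)) * x = 0 := by
  rw [← ZMod.natCast_zmod_val x, map_natCast, ZMod.natCast_eq_zero_iff] at hx
  rw [← ZMod.natCast_zmod_val x, ← Nat.cast_mul, ZMod.natCast_eq_zero_iff]
  exact (sq p).dvd.trans (mul_dvd_mul_left p hx)

theorem natCast_mul_inv_of_mem_Icc {p i : ℕ} (hp : p.Prime) (hi : i ∈ Finset.Icc 1 (p - 1)) :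
    (i : ZMod (p ^ 2)) * (i : ZMod (p ^ 2))⁻¹ = 1 := by
  rw [Finset.mem_Icc] at hi
  exact ZMod.coe_mul_inv_eq_one i
    (Nat.Coprime.pow_right 2 (Nat.coprime_of_lt_prime (by lia) (by lia) hp).symm)

/-- Wolstenholme's theorem. -/
theorem sum_Icc_natCast_inv_eq_zero (p : ℕ) (hp : p.Prime) (hp3 : 3 < p) :
    ∑ i ∈ Finset.Icc 1 (p - 1), (i : ZMod (p ^ 2))⁻¹ = 0 := by
  have : Fact p.Prime := ⟨hp⟩
  have h_reflect : ∑ i ∈ Finset.Icc 1 (p - 1), (i : ZMod (p ^ 2))⁻¹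
      = ∑ i ∈ Finset.Icc 1 (p - 1), ((p - i : ℕ) : ZMod (p ^ 2))⁻¹ := by
    refine Finset.sum_nbij' (p - ·) (p - ·) ?_ ?_ ?_ ?_ ?_ <;> intro i hi <;>
      rw [Finset.mem_Icc] at hi
    · rw [Finset.mem_Icc]; lia
    · rw [Finset.mem_Icc]; lia
    · lia
    · lia
    · rw [Nat.sub_sub_self (by lia)]
  have h_pair : ∀ i ∈ Finset.Icc 1 (p - 1),
      (i : ZMod (p ^ 2))⁻¹ + ((p - i : ℕ) : ZMod (p ^ 2))⁻¹
        = -(p * ((i : ZMod (p ^ 2))⁻¹) ^ 2) := by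
    intro i hi
    have h_mem : p - i ∈ Finset.Icc 1 (p - 1) := by rw [Finset.mem_Icc] at hi ⊢; lia
    have h₁ := natCast_mul_inv_of_mem_Icc hp hi
    have h₂ := natCast_mul_inv_of_mem_Icc hp h_mem
    have h_sq : (p : ZMod (p ^ 2)) ^ 2 = 0 := by exact_mod_cast ZMod.natCast_self (p ^ 2)
    rw [Finset.mem_Icc] at hi
    generalize ((p - i : ℕ) : ZMod (p ^ 2))⁻¹ = b at h₂ ⊢
    rw [Nat.cast_sub (by lia)] at h₂
    generalize (i : ZMod (p ^ 2))⁻¹ = a at h₁ ⊢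
    grind
  have h_cast : (p : ZMod (p ^ 2)) * ∑ i ∈ Finset.Icc 1 (p - 1), ((i : ZMod (p ^ 2))⁻¹) ^ 2 = 0 := by
    apply natCast_mul_eq_zero_of_castHom_eq_zero
    rw [map_sum, ← sum_Icc_natCast_inv_sq_eq_zero p hp3]
    refine Finset.sum_congr rfl fun i hi => ?_
    rw [map_pow]
    congr 1
    refine eq_inv_of_mul_eq_one_right ?_
    rw [← map_natCast (ZMod.castHom (dvd_pow_self p two_ne_zero) (ZMod p)) i, ← map_mul,
      natCast_mul_inv_of_mem_Icc hp hi, map_one]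
  have h_two : (2 : ZMod (p ^ 2)) * (2 : ZMod (p ^ 2))⁻¹ = 1 := by
    exact_mod_cast natCast_mul_inv_of_mem_Icc (i := 2) hp (by rw [Finset.mem_Icc]; lia)
  have h_double := Finset.sum_congr rfl h_pair
  rw [Finset.sum_add_distrib, ← h_reflect, Finset.sum_neg_distrib, ← Finset.mul_sum, h_cast]
    at h_double
  linear_combination (2 : ZMod (p ^ 2))⁻¹ * h_double
    - (∑ i ∈ Finset.Icc 1 (p - 1), (i : ZMod (p ^ 2))⁻¹) * h_two

theorem alternating_sum_inv (p : ℕ) (hp : p.Prime) (hp3 : 3 < p) :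
    ∑ i ∈ Finset.Icc 1 (p - 1), (-1 : ZMod (p ^ 2)) ^ i * (i : ZMod (p ^ 2))⁻¹
      = ∑ i ∈ Finset.Icc 1 ((p - 1) / 2), (i : ZMod (p ^ 2))⁻¹ := by
  obtain ⟨m, rfl⟩ := hp.odd_of_ne_two (by lia)
  have h_split := sum_Icc_neg_one_pow_mul_add_sum
    (fun i : ℕ => (i : ZMod ((2 * m + 1) ^ 2))⁻¹) m
  have h_zero := sum_Icc_natCast_inv_eq_zero _ hp hp3
  rw [Nat.add_sub_cancel] at h_zero ⊢
  rw [h_zero, add_zero] at h_split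
  rw [h_split, Nat.mul_div_cancel_left m two_pos]
  refine Finset.sum_congr rfl fun i hi => ?_
  rw [Finset.mem_Icc] at hi
  have h₁ := natCast_mul_inv_of_mem_Icc (i := i) hp (by rw [Finset.mem_Icc]; lia)
  have h₂ := natCast_mul_inv_of_mem_Icc (i := 2 * i) hp (by rw [Finset.mem_Icc]; lia)
  generalize ((2 * i : ℕ) : ZMod ((2 * m + 1) ^ 2))⁻¹ = b at h₂ ⊢
  generalize (i : ZMod ((2 * m + 1) ^ 2))⁻¹ = a at h₁ ⊢
  push_cast at h₂
  linear_combination a * h₂ - 2 * b * h₁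
end

section
/- Let p be a prime with p > 3, and let i be an integer with 1 ≤ i ≤ p - 1. Then the binomial coefficient C(p, i) is congruent, modulo p^3, to (-1)^i · ( -p · (1/i) + p^2 · Σ_{j=1}^{i-1} 1/(i·j) ), where 1/a denotes the multiplicative inverse of a modulo p^3. -/
theorem ZMod.natCast_mul_inv_of_lt_prime {p : ℕ} (hp : p.Prime) (n : ℕ) {a : ℕ} (ha : 1 ≤ a)
    (hap : a < p) : (a : ZMod (p ^ n)) * (a : ZMod (p ^ n))⁻¹ = 1 :=
  ZMod.coe_mul_inv_eq_one a ((Nat.coprime_of_lt_prime (by omega) hap hp).symm.pow_right n)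

theorem ZMod.choose_prime_succ_eq {p : ℕ} (hp : p.Prime) {k : ℕ} (hk : k + 1 < p) :
    (Nat.choose p (k + 1) : ZMod (p ^ 3)) =
      (-1) ^ (k + 1) * ((k + 1 : ℕ) : ZMod (p ^ 3))⁻¹ *
        (-p + p ^ 2 * ∑ j ∈ Finset.Icc 1 k, (j : ZMod (p ^ 3))⁻¹) := by
  induction k with
  | zero => simp
  | succ k ih =>
    have hp3 : (p : ZMod (p ^ 3)) ^ 3 = 0 := by
      exact_mod_cast ZMod.natCast_self (p ^ 3)
    have h1 := ZMod.natCast_mul_inv_of_lt_prime hp 3 (a := k + 1) (by omega) (by omega)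
    have h2 := ZMod.natCast_mul_inv_of_lt_prime hp 3 (a := k + 1 + 1) (by omega) hk
    have hrec := congrArg (Nat.cast (R := ZMod (p ^ 3))) (Nat.choose_succ_right_eq p (k + 1))
    rw [Nat.cast_mul, Nat.cast_mul, Nat.cast_sub (by omega), ih (by omega)] at hrec
    rw [Finset.sum_Icc_succ_top (by omega)]
    generalize ((k + 1 : ℕ) : ZMod (p ^ 3)) = a at *
    generalize ((k + 1 + 1 : ℕ) : ZMod (p ^ 3)) = b at *
    generalize ∑ j ∈ Finset.Icc 1 k, (j : ZMod (p ^ 3))⁻¹ = H at *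
    generalize (Nat.choose p (k + 1 + 1) : ZMod (p ^ 3)) = c at *
    generalize a⁻¹ = x at *
    generalize b⁻¹ = y at *
    rw [pow_succ _ (k + 1)]
    generalize (-1 : ZMod (p ^ 3)) ^ (k + 1) = s at *
    linear_combination y * hrec - c * h2 + s * x * y * H * hp3
      + s * y * (p - p ^ 2 * H) * h1

theorem choose_p_mod_cube (p : ℕ) (hp : p.Prime) (hp3 : 3 < p)
    (i : ℕ) (hi : 1 ≤ i) (hi2 : i ≤ p - 1) :
    (Nat.choose p i : ZMod (p ^ 3))
      = (-1 : ZMod (p ^ 3)) ^ i *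
        (-(p : ZMod (p ^ 3)) * (i : ZMod (p ^ 3))⁻¹
          + (p : ZMod (p ^ 3)) ^ 2 * ∑ j ∈ Finset.Icc 1 (i - 1), ((i * j : ℕ) : ZMod (p ^ 3))⁻¹) := by
  obtain ⟨k, rfl⟩ := Nat.exists_eq_add_of_le' hi
  have hsum : ∑ j ∈ Finset.Icc 1 (k + 1 - 1), (((k + 1) * j : ℕ) : ZMod (p ^ 3))⁻¹ =
      ((k + 1 : ℕ) : ZMod (p ^ 3))⁻¹ * ∑ j ∈ Finset.Icc 1 k, (j : ZMod (p ^ 3))⁻¹ := by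
    rw [Finset.mul_sum]
    refine Finset.sum_congr (by simp) fun j hj => ?_
    rw [Finset.mem_Icc] at hj
    have h1 := ZMod.natCast_mul_inv_of_lt_prime hp 3 hi (by omega)
    have h2 := ZMod.natCast_mul_inv_of_lt_prime hp 3 hj.1 (by omega)
    apply ZMod.inv_eq_of_mul_eq_one
    rw [Nat.cast_mul, mul_mul_mul_comm, h1, h2, one_mul]
  rw [hsum, ZMod.choose_prime_succ_eq hp (by omega)]
  ring
end

section
/- Let p be a prime with p > 3. Then, modulo p^3, 2^(p-1) is congruent to 1 - (p/2) · Σ_{i=1}^{p-1} (-1)^i / i + (p^2/2) · Σ_{0 < j < i < p} (-1)^i / (i·j), where 1/a denotes the multiplicative inverse of a modulo p^3 and 1/2 the inverse of 2 modulo p^3. -/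
/-- If `0 < i < p` with `p` prime, then `i` is invertible modulo every power of `p`. -/
theorem natCast_mul_inv_zmod_prime_pow {p i : ℕ} (k : ℕ) (hp : p.Prime) (hi : 0 < i)
    (hip : i < p) : (i : ZMod (p ^ k)) * (i : ZMod (p ^ k))⁻¹ = 1 :=
  ZMod.coe_mul_inv_eq_one _ ((Nat.coprime_of_lt_prime hi.ne' hip hp).symm.pow_right k)

/-- Modulo `p ^ 3`, one has `p * (p - 1).choose i = p * (-1) ^ i * (1 - p * H i)`, where `H i` is
the `i`-th harmonic number. -/
theorem prime_mul_choose_zmod_cube {p : ℕ} (hp : p.Prime) (i : ℕ) (hi : i < p) :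
    (p : ZMod (p ^ 3)) * ((p - 1).choose i : ZMod (p ^ 3))
      = p * (-1) ^ i * (1 - p * ∑ j ∈ Finset.Ico 1 (i + 1), (j : ZMod (p ^ 3))⁻¹) := by
  have hp0 : (p : ZMod (p ^ 3)) ^ 3 = 0 := by exact_mod_cast ZMod.natCast_self (p ^ 3)
  induction i with
  | zero => simp
  | succ i ih =>
    have hinv := natCast_mul_inv_zmod_prime_pow 3 hp i.succ_pos hi
    have hchoose := congrArg (Nat.cast (R := ZMod (p ^ 3))) (Nat.choose_succ_right_eq (p - 1) i)
    rw [Nat.sub_sub, Nat.cast_mul, Nat.cast_mul, Nat.cast_sub (by omega)] at hchoose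
    rw [Finset.sum_Ico_succ_top (by omega)]
    have ih := ih (by omega)
    push_cast at hchoose hinv ⊢
    set S := ∑ j ∈ Finset.Ico 1 (i + 1), (j : ZMod (p ^ 3))⁻¹
    set u := ((i : ZMod (p ^ 3)) + 1)⁻¹
    linear_combination (-(p : ZMod (p ^ 3)) * (p - 1).choose (i + 1)
      - (p - 1).choose i * p) * hinv + p * u * hchoose + (p * u - 1) * ih
      - (-1) ^ i * u * S * hp0

/-- Modulo `p ^ 3`, the binomial coefficient `p.choose i` with `0 < i < p` equals
`-(-1) ^ i * p / i * (1 - p * H (i - 1))`, where `H i` is the `i`-th harmonic number. -/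
theorem choose_prime_zmod_cube {p : ℕ} (hp : p.Prime) {i : ℕ} (hi : 0 < i) (hip : i < p) :
    (p.choose i : ZMod (p ^ 3))
      = -(p * ((-1) ^ i * (i : ZMod (p ^ 3))⁻¹))
        + p ^ 2 * ∑ j ∈ Finset.Ico 1 i, (-1) ^ i * ((i * j : ℕ) : ZMod (p ^ 3))⁻¹ := by
  have hinv := natCast_mul_inv_zmod_prime_pow 3 hp hi hip
  have hsum : ∑ j ∈ Finset.Ico 1 i, (-1) ^ i * ((i * j : ℕ) : ZMod (p ^ 3))⁻¹
      = (-1) ^ i * (i : ZMod (p ^ 3))⁻¹ * ∑ j ∈ Finset.Ico 1 i, (j : ZMod (p ^ 3))⁻¹ := by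
    rw [Finset.mul_sum]
    refine Finset.sum_congr rfl fun j hj => ?_
    rw [Finset.mem_Ico] at hj
    have hinvj := natCast_mul_inv_zmod_prime_pow 3 hp hj.1 (hj.2.trans hip)
    rw [mul_assoc, ZMod.inv_eq_of_mul_eq_one]
    push_cast
    linear_combination (j * (j : ZMod (p ^ 3))⁻¹) * hinv + hinvj
  obtain ⟨k, rfl⟩ : ∃ k, i = k + 1 := ⟨i - 1, by omega⟩
  have habs := congrArg (Nat.cast (R := ZMod (p ^ 3))) (Nat.add_one_mul_choose_eq (p - 1) k)
  rw [Nat.sub_add_cancel hp.one_le] at habs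
  have hH := prime_mul_choose_zmod_cube hp k (by omega)
  rw [hsum]
  push_cast at habs hinv ⊢
  set S := ∑ j ∈ Finset.Ico 1 (k + 1), (j : ZMod (p ^ 3))⁻¹
  set u := ((k : ZMod (p ^ 3)) + 1)⁻¹
  linear_combination (-(p.choose (k + 1) : ZMod (p ^ 3))) * hinv - u * habs + u * hH


theorem two_pow_p_sub_one_mod_cube (p : ℕ) (hp : p.Prime) (hp3 : 3 < p) :
    (2 : ZMod (p ^ 3)) ^ (p - 1)
      = 1 - (p : ZMod (p ^ 3)) * (2 : ZMod (p ^ 3))⁻¹ *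
            ∑ i ∈ Finset.Icc 1 (p - 1), (-1 : ZMod (p ^ 3)) ^ i * (i : ZMod (p ^ 3))⁻¹
        + (p : ZMod (p ^ 3)) ^ 2 * (2 : ZMod (p ^ 3))⁻¹ *
            ∑ i ∈ Finset.Ico 1 p, ∑ j ∈ Finset.Ico 1 i,
              (-1 : ZMod (p ^ 3)) ^ i * ((i * j : ℕ) : ZMod (p ^ 3))⁻¹ := by
  have hinv := natCast_mul_inv_zmod_prime_pow 3 hp two_pos (by omega)
  have hIcc : Finset.Icc 1 (p - 1) = Finset.Ico 1 p := by
    ext i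
    simp only [Finset.mem_Icc, Finset.mem_Ico]
    omega
  have hpow : (2 : ZMod (p ^ 3)) ^ p = 2 + ∑ i ∈ Finset.Ico 1 p, (p.choose i : ZMod (p ^ 3)) := by
    have h := congrArg (Nat.cast (R := ZMod (p ^ 3))) (Nat.sum_range_choose p)
    rw [Finset.sum_range_succ, Finset.range_eq_Ico, Finset.sum_eq_sum_Ico_succ_bot hp.pos] at h
    push_cast [Nat.choose_self, Nat.choose_zero_right] at h
    linear_combination -h
  rw [Finset.sum_congr rfl fun i hi => choose_prime_zmod_cube hp (Finset.mem_Ico.1 hi).1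
    (Finset.mem_Ico.1 hi).2, Finset.sum_add_distrib, Finset.sum_neg_distrib, ← Finset.mul_sum,
    ← Finset.mul_sum, ← pow_sub_one_mul hp.ne_zero] at hpow
  rw [hIcc]
  push_cast at hinv hpow ⊢
  linear_combination (1 - (2 : ZMod (p ^ 3)) ^ (p - 1)) * hinv + (2 : ZMod (p ^ 3))⁻¹ * hpow
end

section
/- Let p be a prime with p > 3, and write H = Σ_{i=1}^{(p-1)/2} 1/i, where 1/a denotes the multiplicative inverse of a modulo p^3. Then, modulo p^3, 2^(2p-2) is congruent to 1 - p·H + p^2 · ( (1/4)·H^2 + Σ_{0 < j < i < p} (-1)^i / (i·j) ), where 1/4 denotes the inverse of 4 modulo p^3. -/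
open Finset

namespace ZMod

section PrimeCube

variable {p : ℕ}

theorem natCast_mul_inv_of_lt_prime_s9 (hp : p.Prime) {i : ℕ} (h0 : 0 < i) (hi : i < p) :
    (i : ZMod (p ^ 3)) * (i : ZMod (p ^ 3))⁻¹ = 1 :=
  coe_mul_inv_eq_one i ((Nat.coprime_of_lt_prime h0.ne' hi hp).symm.pow_right 3)

theorem natCast_prime_cube : (p : ZMod (p ^ 3)) ^ 3 = 0 := by
  exact_mod_cast natCast_self (p ^ 3)

theorem sq_mul_eq_zero_of_castHom_eq_zero (hp : p.Prime) {x : ZMod (p ^ 3)}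
    (h : castHom (dvd_pow_self p three_ne_zero) (ZMod p) x = 0) :
    (p : ZMod (p ^ 3)) ^ 2 * x = 0 := by
  have : NeZero (p ^ 3) := ⟨pow_ne_zero 3 hp.ne_zero⟩
  rw [← natCast_zmod_val x] at h ⊢
  rw [map_natCast, natCast_eq_zero_iff] at h
  obtain ⟨c, hc⟩ := h
  rw [hc]
  push_cast
  linear_combination (c : ZMod (p ^ 3)) * natCast_prime_cube (p := p)

theorem sum_Ico_inv_sq_eq_zero (hp : p.Prime) (hp3 : 3 < p) :
    ∑ i ∈ Ico 1 p, ((i : ZMod p)⁻¹) ^ 2 = 0 := by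
  have : Fact p.Prime := ⟨hp⟩
  have hsum : ∑ x : ZMod p, x⁻¹ ^ 2 = 0 := by
    rw [← FiniteField.sum_pow_lt_card_sub_one (ZMod p) 2 (by rw [card]; omega)]
    exact Equiv.sum_comp (Equiv.inv (ZMod p)) (fun x => x ^ 2)
  have hrange : ∑ i ∈ range p, ((i : ZMod p)⁻¹) ^ 2 = ∑ x : ZMod p, x⁻¹ ^ 2 := by
    refine sum_bij' (fun i _ => (i : ZMod p)) (fun x _ => x.val) (by simp)
      (fun x _ => mem_range.2 x.val_lt) (fun i hi => val_cast_of_lt (mem_range.1 hi))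
      (fun x _ => natCast_zmod_val x) (by simp)
  rw [← hsum, ← hrange, range_eq_Ico, sum_eq_sum_Ico_succ_bot hp.pos]
  simp

theorem sq_mul_sum_Ico_inv_sq (hp : p.Prime) (hp3 : 3 < p) :
    (p : ZMod (p ^ 3)) ^ 2 * ∑ i ∈ Ico 1 p, ((i : ZMod (p ^ 3))⁻¹) ^ 2 = 0 := by
  have : Fact p.Prime := ⟨hp⟩
  refine sq_mul_eq_zero_of_castHom_eq_zero hp ?_
  rw [map_sum, ← sum_Ico_inv_sq_eq_zero hp hp3]
  refine sum_congr rfl fun i hi => ?_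
  rw [mem_Ico] at hi
  rw [map_pow]
  congr 1
  have h := congrArg (castHom (dvd_pow_self p three_ne_zero) (ZMod p))
    (natCast_mul_inv_of_lt_prime_s9 hp hi.1 hi.2)
  rw [map_mul, map_natCast, map_one] at h
  exact eq_inv_of_mul_eq_one_right h

theorem two_mul_inv_two (hp : p.Prime) (hp3 : 3 < p) :
    (2 : ZMod (p ^ 3)) * (2 : ZMod (p ^ 3))⁻¹ = 1 := by
  exact_mod_cast natCast_mul_inv_of_lt_prime_s9 hp two_pos (by omega : 2 < p)

/-- Wolstenholme's theorem, multiplied by `p`. -/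
theorem mul_sum_Ico_inv_eq_zero (hp : p.Prime) (hp3 : 3 < p) :
    (p : ZMod (p ^ 3)) * ∑ i ∈ Ico 1 p, (i : ZMod (p ^ 3))⁻¹ = 0 := by
  have hreflect : ∑ i ∈ Ico 1 p, ((p - i : ℕ) : ZMod (p ^ 3))⁻¹
      = ∑ i ∈ Ico 1 p, (i : ZMod (p ^ 3))⁻¹ := by
    refine sum_bij' (fun i _ => p - i) (fun i _ => p - i) ?_ ?_ ?_ ?_ ?_ <;>
      intro i hi <;> simp only [mem_Ico] at hi ⊢ <;> omega
  have hpair : (p : ZMod (p ^ 3)) * ∑ i ∈ Ico 1 p,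
      ((i : ZMod (p ^ 3))⁻¹ + ((p - i : ℕ) : ZMod (p ^ 3))⁻¹) = 0 := by
    rw [← neg_eq_zero, ← sq_mul_sum_Ico_inv_sq hp hp3, mul_sum, mul_sum, ← sum_neg_distrib]
    refine sum_congr rfl fun i hi => ?_
    rw [mem_Ico] at hi
    have h1 := natCast_mul_inv_of_lt_prime_s9 hp hi.1 hi.2
    have h2 := natCast_mul_inv_of_lt_prime_s9 hp (by omega : 0 < p - i) (by omega)
    have h3 : ((p - i : ℕ) : ZMod (p ^ 3)) = p - i := by rw [Nat.cast_sub hi.2.le]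
    generalize ((p - i : ℕ) : ZMod (p ^ 3))⁻¹ = v at *
    rw [h3] at h2
    have h4 := natCast_prime_cube (p := p)
    generalize (i : ZMod (p ^ 3))⁻¹ = u at *
    generalize (i : ZMod (p ^ 3)) = a at *
    generalize (p : ZMod (p ^ 3)) = q at *
    have e : u + v = q * (u * v) := by linear_combination (-u) * h2 - v * h1
    have e' : u + v = -q * u ^ 2 + q ^ 2 * (u ^ 2 * v) := by
      linear_combination e + q * u * e
    linear_combination -q * e' - u ^ 2 * v * h4
  rw [sum_add_distrib, hreflect] at hpair
  linear_combination (2 : ZMod (p ^ 3))⁻¹ * hpair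
    - (p * ∑ i ∈ Ico 1 p, (i : ZMod (p ^ 3))⁻¹) * two_mul_inv_two hp hp3

theorem mul_choose_prime_sub_one (hp : p.Prime) {k : ℕ} (hk : k < p) :
    (p : ZMod (p ^ 3)) * ((p - 1).choose k : ZMod (p ^ 3))
      = p * (-1) ^ k * (1 - p * ∑ j ∈ Ico 1 (k + 1), (j : ZMod (p ^ 3))⁻¹) := by
  induction k with
  | zero => simp
  | succ k ih =>
    have ih := ih (by omega)
    have hc := congrArg (Nat.cast (R := ZMod (p ^ 3))) (Nat.choose_succ_right_eq (p - 1) k)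
    have hu := natCast_mul_inv_of_lt_prime_s9 hp k.succ_pos hk
    have hs : ((p - 1 - k : ℕ) : ZMod (p ^ 3)) = p - (k + 1 : ℕ) := by
      rw [← Nat.cast_sub hk.le]; congr 1; omega
    rw [sum_Ico_succ_top (by omega)]
    rw [Nat.cast_mul, Nat.cast_mul, hs] at hc
    rw [Nat.succ_eq_add_one] at hu
    have h4 := natCast_prime_cube (p := p)
    generalize ((k + 1 : ℕ) : ZMod (p ^ 3))⁻¹ = u at *
    generalize ((k + 1 : ℕ) : ZMod (p ^ 3)) = a at *
    generalize ∑ j ∈ Ico 1 (k + 1), (j : ZMod (p ^ 3))⁻¹ = s at *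
    generalize ((p - 1).choose (k + 1) : ZMod (p ^ 3)) = c' at *
    generalize ((p - 1).choose k : ZMod (p ^ 3)) = c at *
    generalize (p : ZMod (p ^ 3)) = q at *
    have e : c' = c * (q * u - 1) := by linear_combination u * hc - (c' + c) * hu
    rw [e]
    linear_combination (q * u - 1) * ih - (-1) ^ k * s * u * h4

theorem two_pow_prime_eq (hp : p.Prime) :
    (2 : ZMod (p ^ 3)) ^ p = 2 - p * ∑ i ∈ Ico 1 p, (-1) ^ i * (i : ZMod (p ^ 3))⁻¹
      + p ^ 2 * ∑ i ∈ Ico 1 p, ∑ j ∈ Ico 1 i,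
          (-1 : ZMod (p ^ 3)) ^ i * ((i * j : ℕ) : ZMod (p ^ 3))⁻¹ := by
  have hterm : ∀ i ∈ Ico 1 p, (p.choose i : ZMod (p ^ 3))
      = - (p * ((-1) ^ i * (i : ZMod (p ^ 3))⁻¹)) + p ^ 2 * ∑ j ∈ Ico 1 i,
          (-1 : ZMod (p ^ 3)) ^ i * ((i * j : ℕ) : ZMod (p ^ 3))⁻¹ := by
    intro i hi
    rw [mem_Ico] at hi
    have hinner : ∑ j ∈ Ico 1 i, (-1 : ZMod (p ^ 3)) ^ i * ((i * j : ℕ) : ZMod (p ^ 3))⁻¹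
        = (-1) ^ i * (i : ZMod (p ^ 3))⁻¹ * ∑ j ∈ Ico 1 i, (j : ZMod (p ^ 3))⁻¹ := by
      rw [mul_sum]
      refine sum_congr rfl fun j hj => ?_
      rw [mem_Ico] at hj
      rw [mul_assoc]
      congr 1
      refine ZMod.inv_eq_of_mul_eq_one _ _ _ ?_
      have h1 := natCast_mul_inv_of_lt_prime_s9 hp hi.1 hi.2
      have h2 := natCast_mul_inv_of_lt_prime_s9 hp hj.1 (hj.2.trans hi.2)
      rw [Nat.cast_mul, mul_mul_mul_comm, h1, h2, one_mul]
    have h1 := natCast_mul_inv_of_lt_prime_s9 hp hi.1 hi.2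
    rw [hinner]
    obtain ⟨k, rfl⟩ := Nat.exists_eq_add_of_le' hi.1
    have h2 := mul_choose_prime_sub_one hp (by omega : k < p)
    have h3 := congrArg (Nat.cast (R := ZMod (p ^ 3))) (Nat.add_one_mul_choose_eq (p - 1) k)
    rw [Nat.sub_add_cancel hp.one_le, Nat.cast_mul, Nat.cast_mul] at h3
    generalize ∑ j ∈ Ico 1 (k + 1), (j : ZMod (p ^ 3))⁻¹ = s at *
    generalize ((k + 1 : ℕ) : ZMod (p ^ 3))⁻¹ = u at *
    linear_combination u * h2 - u * h3 - (p.choose (k + 1) : ZMod (p ^ 3)) * h1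
  have hbinom : (2 : ZMod (p ^ 3)) ^ p = 2 + ∑ i ∈ Ico 1 p, (p.choose i : ZMod (p ^ 3)) := by
    have h := congrArg (Nat.cast (R := ZMod (p ^ 3))) (Nat.sum_range_choose p)
    rw [sum_range_succ, range_eq_Ico, sum_eq_sum_Ico_succ_bot hp.pos] at h
    push_cast [Nat.choose_self, Nat.choose_zero_right] at h
    rw [← h]
    ring
  rw [hbinom, sum_congr rfl hterm, sum_add_distrib, sum_neg_distrib, ← mul_sum, ← mul_sum]
  ring

theorem sum_Ico_neg_one_pow_mul_inv (hp : p.Prime) {m : ℕ} (hm : 2 * m < p) :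
    ∑ i ∈ Ico 1 (2 * m + 1), (-1) ^ i * (i : ZMod (p ^ 3))⁻¹
      = ∑ i ∈ Icc 1 m, (i : ZMod (p ^ 3))⁻¹ - ∑ i ∈ Ico 1 (2 * m + 1), (i : ZMod (p ^ 3))⁻¹ := by
  induction m with
  | zero => simp
  | succ m ih =>
    have ih := ih (by omega)
    have h1 := natCast_mul_inv_of_lt_prime_s9 hp m.succ_pos (by omega)
    have h2 := natCast_mul_inv_of_lt_prime_s9 hp (by omega : 0 < 2 * m + 1 + 1) hm
    have h3 : ((2 * m + 1 + 1 : ℕ) : ZMod (p ^ 3)) = 2 * (m + 1 : ℕ) := by push_cast; ring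
    rw [show 2 * (m + 1) + 1 = 2 * m + 1 + 1 + 1 by ring, sum_Icc_succ_top (by omega)]
    simp only [sum_Ico_succ_top (show 1 ≤ 2 * m + 1 + 1 by omega),
      sum_Ico_succ_top (show 1 ≤ 2 * m + 1 by omega)]
    rw [ih, Odd.neg_one_pow ⟨m, rfl⟩,
      Even.neg_one_pow ⟨m + 1, by ring⟩]
    rw [Nat.succ_eq_add_one] at h1
    generalize ((2 * m + 1 + 1 : ℕ) : ZMod (p ^ 3))⁻¹ = v at *
    rw [h3] at h2
    linear_combination ((m + 1 : ℕ) : ZMod (p ^ 3))⁻¹ * h2 - 2 * v * h1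

end PrimeCube

end ZMod

theorem two_pow_sq_mod_cube (p : ℕ) (hp : p.Prime) (hp3 : 3 < p)
    (H : ZMod (p ^ 3)) (hH : H = ∑ i ∈ Finset.Icc 1 ((p - 1) / 2), (i : ZMod (p ^ 3))⁻¹) :
    (2 : ZMod (p ^ 3)) ^ (2 * p - 2)
      = 1 - (p : ZMod (p ^ 3)) * H
        + (p : ZMod (p ^ 3)) ^ 2 *
            ((4 : ZMod (p ^ 3))⁻¹ * H ^ 2
              + ∑ i ∈ Finset.Ico 1 p, ∑ j ∈ Finset.Ico 1 i,
                  (-1 : ZMod (p ^ 3)) ^ i * ((i * j : ℕ) : ZMod (p ^ 3))⁻¹) := by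
  have hodd : 2 * ((p - 1) / 2) + 1 = p := by
    have := hp.eq_two_or_odd
    omega
  have hA := ZMod.sum_Ico_neg_one_pow_mul_inv hp (m := (p - 1) / 2) (by omega)
  rw [hodd, ← hH] at hA
  have hW := ZMod.mul_sum_Ico_inv_eq_zero hp hp3
  have hpow := ZMod.two_pow_prime_eq hp
  have h2 := ZMod.two_mul_inv_two hp hp3
  have h4 : (4 : ZMod (p ^ 3))⁻¹ = (2 : ZMod (p ^ 3))⁻¹ ^ 2 :=
    ZMod.inv_eq_of_mul_eq_one _ _ _ (by
      linear_combination (2 * (2 : ZMod (p ^ 3))⁻¹ + 1) * h2)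
  have hcube := ZMod.natCast_prime_cube (p := p)
  rw [hA, ← pow_sub_one_mul hp.ne_zero] at hpow
  rw [show 2 * p - 2 = (p - 1) * 2 by omega, pow_mul, h4]
  generalize ∑ i ∈ Ico 1 p, ∑ j ∈ Ico 1 i,
    (-1 : ZMod (p ^ 3)) ^ i * ((i * j : ℕ) : ZMod (p ^ 3))⁻¹ = S at *
  generalize ∑ i ∈ Ico 1 p, (i : ZMod (p ^ 3))⁻¹ = W at *
  generalize (2 : ZMod (p ^ 3)) ^ (p - 1) = x at *
  generalize (2 : ZMod (p ^ 3))⁻¹ = t at *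
  generalize (p : ZMod (p ^ 3)) = q at *
  have hx : x = 1 - q * H * t + q ^ 2 * S * t := by
    linear_combination t * hpow + t * hW + (1 - x) * h2
  rw [hx]
  linear_combination (-q * H + q ^ 2 * S) * h2 + (-2 * H * S * t ^ 2 + q * S ^ 2 * t ^ 2) * hcube
end

section
/- Let p be a prime with p > 3. Then, modulo p, the square of the sum Σ 1/i taken over even integers i with 0 < i < p is congruent to the double sum Σ_{0 < j < i < p} (-1)^i / (i·j), where 1/a denotes the multiplicative inverse of a modulo p. -/
open Finset

/-- The harmonic number `1 + 1/2 + ⋯ + 1/n` in a field. -/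
def harmonicIn (K : Type*) [Field K] (n : ℕ) : K := ∑ j ∈ range n, ((j : K) + 1)⁻¹

section Field

variable {K : Type*} [Field K]

theorem harmonicIn_zero : harmonicIn K 0 = 0 := by simp [harmonicIn]

theorem harmonicIn_succ (n : ℕ) : harmonicIn K (n + 1) = harmonicIn K n + ((n : K) + 1)⁻¹ :=
  sum_range_succ _ _

theorem sum_inv_mul_harmonicIn_add (n : ℕ) :
    ∑ a ∈ range n, ((a : K) + 1)⁻¹ * (harmonicIn K (a + 1) + harmonicIn K a)
      = harmonicIn K n ^ 2 := by
  induction n with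
  | zero => simp [harmonicIn_zero]
  | succ n ih => rw [sum_range_succ, ih, harmonicIn_succ]; ring

theorem sum_inv_mul_inv_reflect (n : ℕ) (h : ∀ j < n + 1, (j : K) + 1 ≠ 0) :
    ∑ a ∈ range n, ((a : K) + 1)⁻¹ * (((n - 1 - a : ℕ) : K) + 1)⁻¹
      = 2 * ((n : K) + 1)⁻¹ * harmonicIn K n := by
  have hterm : ∀ a ∈ range n, ((a : K) + 1)⁻¹ * (((n - 1 - a : ℕ) : K) + 1)⁻¹
      = ((n : K) + 1)⁻¹ * (((a : K) + 1)⁻¹ + (((n - 1 - a : ℕ) : K) + 1)⁻¹) := by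
    intro a ha
    have ha' := mem_range.1 ha
    have h1 := h a (by omega)
    have h2 := h (n - 1 - a) (by omega)
    have h3 := h n (by omega)
    have hsum : (n : K) + 1 = ((a : K) + 1) + (((n - 1 - a : ℕ) : K) + 1) := by
      have : n + 1 = (a + 1) + ((n - 1 - a) + 1) := by omega
      exact_mod_cast congrArg (Nat.cast : ℕ → K) this
    rw [hsum] at h3 ⊢
    field_simp
    ring
  rw [sum_congr rfl hterm, ← mul_sum, sum_add_distrib,
    sum_range_reflect (fun a => ((a : K) + 1)⁻¹) n]
  unfold harmonicIn
  ring

theorem sum_inv_mul_harmonicIn_reflect (n : ℕ) (h : ∀ j < n, (j : K) + 1 ≠ 0) :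
    ∑ a ∈ range n, ((a : K) + 1)⁻¹ * harmonicIn K (n - 1 - a)
      = harmonicIn K n ^ 2 - ∑ a ∈ range n, (((a : K) + 1)⁻¹) ^ 2 := by
  induction n with
  | zero => simp [harmonicIn_zero]
  | succ n ih =>
    have hstep : ∀ a ∈ range n, ((a : K) + 1)⁻¹ * harmonicIn K (n + 1 - 1 - a)
        = ((a : K) + 1)⁻¹ * harmonicIn K (n - 1 - a)
          + ((a : K) + 1)⁻¹ * (((n - 1 - a : ℕ) : K) + 1)⁻¹ := by
      intro a ha
      have ha' := mem_range.1 ha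
      rw [show n + 1 - 1 - a = (n - 1 - a) + 1 by omega, harmonicIn_succ]
      ring
    rw [sum_range_succ, sum_congr rfl hstep, sum_add_distrib, ih fun j hj => h j (by omega),
      sum_inv_mul_inv_reflect n h, sum_range_succ, harmonicIn_succ,
      show n + 1 - 1 - n = 0 by omega, harmonicIn_zero]
    ring

theorem harmonicIn_two_mul {n : ℕ} (hn : 2 * (n : K) + 1 = 0) (a : ℕ) (ha : a ≤ n) :
    2 * harmonicIn K (2 * a) = harmonicIn K a - harmonicIn K n + harmonicIn K (n - a) := by
  have h2 : (2 : K) ≠ 0 := by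
    intro h
    simp [h] at hn
  induction a with
  | zero => simp [harmonicIn_zero]
  | succ a ih =>
    have ih := ih (by omega)
    have hsub : n - a = (n - (a + 1)) + 1 := by omega
    have hodd : 2 * (2 * (a : K) + 1)⁻¹ = -(((n - (a + 1) : ℕ) : K) + 1)⁻¹ := by
      have hcast : (((n - (a + 1) : ℕ) : K) + 1) = n - a := by
        rw [Nat.cast_sub ha]; push_cast; ring
      have : 2 * (a : K) + 1 = 2 * -(n - a : K) := by linear_combination hn
      rw [hcast, this, mul_inv, mul_inv_cancel_left₀ h2, inv_neg]
    have heven : 2 * (2 * (a : K) + 1 + 1)⁻¹ = ((a : K) + 1)⁻¹ := by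
      rw [show 2 * (a : K) + 1 + 1 = 2 * (a + 1) by ring, mul_inv, mul_inv_cancel_left₀ h2]
    rw [hsub, harmonicIn_succ] at ih
    rw [show 2 * (a + 1) = 2 * a + 1 + 1 by ring, harmonicIn_succ, harmonicIn_succ,
      harmonicIn_succ]
    push_cast
    linear_combination ih + hodd + heven

theorem harmonicIn_two_mul_reflect {n : ℕ} (hn : 2 * (n : K) + 1 = 0) (a : ℕ) (ha : a ≤ n) :
    harmonicIn K (2 * (n - a)) = harmonicIn K (2 * a) := by
  have h2 : (2 : K) ≠ 0 := by
    intro h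
    simp [h] at hn
  have h := harmonicIn_two_mul hn (n - a) (by omega)
  rw [show n - (n - a) = a by omega] at h
  apply mul_left_cancel₀ h2
  rw [h, harmonicIn_two_mul hn a ha]
  ring

theorem sum_range_two_mul_eq {M : Type*} [AddCommMonoid M] (f : ℕ → M) (n : ℕ) :
    ∑ i ∈ range (2 * n), f i = ∑ a ∈ range n, (f (2 * a) + f (2 * a + 1)) := by
  induction n with
  | zero => simp
  | succ n ih =>
    rw [show 2 * (n + 1) = 2 * n + 1 + 1 by ring, sum_range_succ, sum_range_succ, ih,
      sum_range_succ, add_assoc]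

theorem alternating_sum_harmonicIn {n : ℕ} (hn : 2 * (n : K) + 1 = 0)
    (h : ∀ j < n, (j : K) + 1 ≠ 0) :
    ∑ i ∈ range (2 * n), (-1 : K) ^ (i + 1) * (((i : K) + 1)⁻¹ * harmonicIn K i)
      = (2⁻¹ * harmonicIn K n) ^ 2 - 2⁻¹ * ∑ a ∈ range n, (((a : K) + 1)⁻¹) ^ 2 := by
  have h2 : (2 : K) ≠ 0 := by
    intro h
    simp [h] at hn
  have hodd : ∑ a ∈ range n, -((2 * (a : K) + 1)⁻¹ * harmonicIn K (2 * a))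
      = ∑ a ∈ range n, (2 * ((a : K) + 1))⁻¹ * harmonicIn K (2 * (a + 1)) := by
    rw [← sum_range_reflect]
    refine sum_congr rfl fun a ha => ?_
    have ha' := mem_range.1 ha
    rw [show n - 1 - a = n - (a + 1) by omega, harmonicIn_two_mul_reflect hn _ ha',
      Nat.cast_sub ha']
    have : 2 * ((n : K) - ((a + 1 : ℕ) : K)) + 1 = -(2 * ((a : K) + 1)) := by
      push_cast
      linear_combination hn
    rw [this, inv_neg]
    ring
  have hterm : ∀ a ∈ range n,
      (2 * ((a : K) + 1))⁻¹ * harmonicIn K (2 * (a + 1))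
        + (2 * ((a : K) + 1))⁻¹ * harmonicIn K (2 * a + 1)
      = 2⁻¹ ^ 2 * (((a : K) + 1)⁻¹ * (harmonicIn K (a + 1) + harmonicIn K a))
        - 2⁻¹ * harmonicIn K n * ((a : K) + 1)⁻¹
        + 2⁻¹ * (((a : K) + 1)⁻¹ * harmonicIn K (n - 1 - a)) := by
    intro a ha
    have ha' := mem_range.1 ha
    have key := harmonicIn_two_mul hn (a + 1) ha'
    have hs : harmonicIn K (2 * (a + 1)) = harmonicIn K (2 * a + 1) + (2 * ((a : K) + 1))⁻¹ := by
      rw [show 2 * (a + 1) = 2 * a + 1 + 1 by ring, harmonicIn_succ]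
      push_cast
      ring
    have hs' := harmonicIn_succ (K := K) a
    rw [show n - 1 - a = n - (a + 1) by omega]
    rw [mul_inv] at hs ⊢
    have hhalf : (2 : K)⁻¹ * 2 = 1 := inv_mul_cancel₀ h2
    set u := ((a : K) + 1)⁻¹
    linear_combination 2⁻¹ * u * key - 2⁻¹ * u * hs + 2⁻¹ ^ 2 * u * hs'
      - 2⁻¹ * u * harmonicIn K (a + 1) * hhalf
  rw [sum_range_two_mul_eq]
  have hsplit : ∀ a ∈ range n,
      ((-1 : K) ^ (2 * a + 1) * ((((2 * a : ℕ) : K) + 1)⁻¹ * harmonicIn K (2 * a))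
        + (-1 : K) ^ (2 * a + 1 + 1) *
          ((((2 * a + 1 : ℕ) : K) + 1)⁻¹ * harmonicIn K (2 * a + 1)))
      = -((2 * (a : K) + 1)⁻¹ * harmonicIn K (2 * a))
        + (2 * ((a : K) + 1))⁻¹ * harmonicIn K (2 * a + 1) := by
    intro a _
    rw [Odd.neg_one_pow ⟨a, rfl⟩, Even.neg_one_pow ⟨a + 1, by ring⟩]
    push_cast
    rw [show 2 * (a : K) + 1 + 1 = 2 * (a + 1) by ring, neg_one_mul, one_mul]
  rw [sum_congr rfl hsplit, sum_add_distrib, hodd, ← sum_add_distrib, sum_congr rfl hterm,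
    sum_add_distrib, sum_sub_distrib, ← mul_sum, ← mul_sum, ← mul_sum,
    sum_inv_mul_harmonicIn_add, sum_inv_mul_harmonicIn_reflect n h]
  change _ - _ * harmonicIn K n + _ = _
  ring

theorem sum_range_two_mul_inv_sq {n : ℕ} (hn : 2 * (n : K) + 1 = 0) :
    ∑ i ∈ range (2 * n), (((i : K) + 1)⁻¹) ^ 2
      = 2 * ∑ a ∈ range n, (((a : K) + 1)⁻¹) ^ 2 := by
  rw [two_mul n, sum_range_add, two_mul (∑ a ∈ range n, _)]
  congr 1
  rw [← sum_range_reflect]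
  refine sum_congr rfl fun a ha => ?_
  have ha' := mem_range.1 ha
  have : ((n + (n - 1 - a) : ℕ) : K) + 1 = -((a : K) + 1) := by
    rw [show n + (n - 1 - a) = 2 * n - (a + 1) by omega, Nat.cast_sub (by omega)]
    push_cast
    linear_combination hn
  rw [this, inv_neg, neg_sq]

end Field

theorem ZMod.sum_range_inv_sq {m : ℕ} [Fact (m + 1).Prime] (hm : 2 < m) :
    ∑ i ∈ range m, (((i : ZMod (m + 1)) + 1)⁻¹) ^ 2 = 0 := by
  have h0 : ∑ x : ZMod (m + 1), (x⁻¹) ^ 2 = 0 := by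
    rw [← FiniteField.sum_pow_lt_card_sub_one (ZMod (m + 1)) 2 (by simpa [ZMod.card] using hm)]
    exact Equiv.sum_comp (inv_involutive (G := ZMod (m + 1))).toPerm (fun x => x ^ 2)
  have h1 : ∑ x : ZMod (m + 1), (x⁻¹) ^ 2
      = ∑ i ∈ range (m + 1), (((i : ZMod (m + 1)))⁻¹) ^ 2 := by
    rw [← Fin.sum_univ_eq_sum_range (fun i => (((i : ZMod (m + 1)))⁻¹) ^ 2)]
    exact sum_congr rfl fun (x : Fin (m + 1)) _ => by
      congr 2
      exact (ZMod.natCast_zmod_val (n := m + 1) x).symm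
  rw [h1, sum_range_succ'] at h0
  simpa using h0

theorem sum_even_inv_eq {K : Type*} [Field K] (n : ℕ) :
    ∑ i ∈ (Ico 1 (2 * n + 1)).filter (fun i => Even i), (i : K)⁻¹
      = 2⁻¹ * harmonicIn K n := by
  rw [sum_filter, sum_Ico_eq_sum_range, Nat.add_sub_cancel, sum_range_two_mul_eq, harmonicIn,
    mul_sum]
  refine sum_congr rfl fun a _ => ?_
  rw [if_neg (by grind), if_pos (by grind), ← mul_inv, zero_add]
  push_cast
  ring

theorem sq_sum_even_inv (p : ℕ) (hp : p.Prime) (hp3 : 3 < p) :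
    (∑ i ∈ (Finset.Ico 1 p).filter (fun i => Even i), (i : ZMod p)⁻¹) ^ 2
      = ∑ i ∈ Finset.Ico 1 p, ∑ j ∈ Finset.Ico 1 i,
          (-1 : ZMod p) ^ i * ((i * j : ℕ) : ZMod p)⁻¹ := by
  obtain ⟨n, rfl⟩ := hp.odd_of_ne_two (by omega)
  have : Fact (2 * n + 1).Prime := ⟨hp⟩
  have hn : 2 * (n : ZMod (2 * n + 1)) + 1 = 0 := by
    exact_mod_cast ZMod.natCast_self (2 * n + 1)
  have hne : ∀ j < n, (j : ZMod (2 * n + 1)) + 1 ≠ 0 := by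
    intro j hj h
    have h' : ((j + 1 : ℕ) : ZMod (2 * n + 1)) = 0 := by exact_mod_cast h
    have := Nat.le_of_dvd (by omega) ((ZMod.natCast_eq_zero_iff _ _).1 h')
    omega
  have h2 : (2 : ZMod (2 * n + 1)) ≠ 0 := by
    intro h
    simp [h] at hn
  have hsq : ∑ a ∈ range n, (((a : ZMod (2 * n + 1)) + 1)⁻¹) ^ 2 = 0 := by
    have h := ZMod.sum_range_inv_sq (m := 2 * n) (by omega)
    rw [sum_range_two_mul_inv_sq hn] at h
    exact (mul_eq_zero.1 h).resolve_left h2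
  have hS := alternating_sum_harmonicIn hn hne
  rw [hsq, mul_zero, sub_zero] at hS
  rw [sum_even_inv_eq, ← hS, sum_Ico_eq_sum_range, Nat.add_sub_cancel]
  refine sum_congr rfl fun i _ => ?_
  rw [sum_Ico_eq_sum_range, Nat.add_sub_cancel_left, harmonicIn, mul_sum, mul_sum, add_comm 1 i]
  refine sum_congr rfl fun j _ => ?_
  push_cast
  rw [mul_inv, add_comm 1 (j : ZMod (2 * n + 1))]
end

section
/- Let p be a prime with p > 3. Then, modulo p, the sum of 1/(i·j) over all pairs (i, j) with 0 < j < i < p and both i and j odd is congruent to the sum of 1/(i·j) over all pairs (i, j) with 0 < i < j < p and both i and j even, where 1/a denotes the multiplicative inverse of a modulo p. -/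
theorem odd_odd_sum_eq_even_even_sum (p : ℕ) (hp : p.Prime) (hp3 : 3 < p) :
    ∑ i ∈ (Finset.Ico 1 p).filter (fun i => Odd i),
      ∑ j ∈ (Finset.Ico 1 i).filter (fun j => Odd j), ((i * j : ℕ) : ZMod p)⁻¹
      = ∑ j ∈ (Finset.Ico 1 p).filter (fun j => Even j),
          ∑ i ∈ (Finset.Ico 1 j).filter (fun i => Even i), ((i * j : ℕ) : ZMod p)⁻¹ := by
  have hodd : p % 2 = 1 := Nat.odd_iff.mp (hp.odd_of_ne_two (by omega))
  rw [Finset.sum_sigma', Finset.sum_sigma']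
  -- the reflection `a ↦ p - a ≡ -a` swaps parities and reverses the order
  refine Finset.sum_bij' (fun x _ => ⟨p - x.2, p - x.1⟩) (fun x _ => ⟨p - x.2, p - x.1⟩)
    ?_ ?_ ?_ ?_ ?_ <;> rintro ⟨a, b⟩ hab <;>
    simp only [Finset.mem_sigma, Finset.mem_filter, Finset.mem_Ico, Nat.odd_iff,
      Nat.even_iff] at hab ⊢
  · omega
  · omega
  · rw [Nat.sub_sub_self (by omega), Nat.sub_sub_self (by omega)]
  · rw [Nat.sub_sub_self (by omega), Nat.sub_sub_self (by omega)]
  · rw [Nat.cast_mul, Nat.cast_mul, Nat.cast_sub (by omega), Nat.cast_sub (by omega)]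
    simp
end

section
/- Let p be a prime with p > 3. Write A for the sum of 1/(i·j) over all pairs (i, j) with 0 < j < i < p, i odd and j even, and B for the sum of 1/(i·j) over all pairs (i, j) with 0 < i < j < p, i odd and j even, where 1/a denotes the multiplicative inverse of a modulo p. Then Σ_{0 < j < i < p} (-1)^i / (i·j) ≡ -A + B (mod p). -/
/-- The reflection `(i, j) ↦ (p - j, p - i)` exchanges the pairs of even numbers below an odd `p`
with the pairs of odd numbers, and preserves `1 / (i * j)` modulo `p`. -/
lemma sum_even_even_eq_sum_odd_odd {p : ℕ} (hp : Odd p) :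
    (∑ i ∈ Finset.Ico 1 p, ∑ j ∈ Finset.Ico 1 i,
        if Even i ∧ Even j then ((i * j : ℕ) : ZMod p)⁻¹ else 0)
      = ∑ i ∈ Finset.Ico 1 p, ∑ j ∈ Finset.Ico 1 i,
        if Odd i ∧ Odd j then ((i * j : ℕ) : ZMod p)⁻¹ else 0 := by
  rw [Finset.sum_sigma', Finset.sum_sigma']
  refine Finset.sum_nbij' (fun x => ⟨p - x.2, p - x.1⟩) (fun x => ⟨p - x.2, p - x.1⟩)
    ?_ ?_ ?_ ?_ ?_
  · rintro ⟨i, j⟩ h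
    simp only [Finset.mem_sigma, Finset.mem_Ico] at h ⊢
    omega
  · rintro ⟨i, j⟩ h
    simp only [Finset.mem_sigma, Finset.mem_Ico] at h ⊢
    omega
  · rintro ⟨i, j⟩ h
    simp only [Finset.mem_sigma, Finset.mem_Ico] at h
    simp only [Nat.sub_sub_self h.1.2.le, Nat.sub_sub_self (h.2.2.trans h.1.2).le]
  · rintro ⟨i, j⟩ h
    simp only [Finset.mem_sigma, Finset.mem_Ico] at h
    simp only [Nat.sub_sub_self h.1.2.le, Nat.sub_sub_self (h.2.2.trans h.1.2).le]
  · rintro ⟨i, j⟩ h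
    simp only [Finset.mem_sigma, Finset.mem_Ico] at h
    have hi : i ≤ p := h.1.2.le
    have hj : j ≤ p := (h.2.2.trans h.1.2).le
    have hprod : (((p - j) * (p - i) : ℕ) : ZMod p) = ((i * j : ℕ) : ZMod p) := by
      push_cast [Nat.cast_sub hi, Nat.cast_sub hj]
      rw [ZMod.natCast_self]
      ring
    have hpar : (Odd (p - j) ∧ Odd (p - i)) ↔ (Even i ∧ Even j) := by
      simp [Nat.odd_sub hi, Nat.odd_sub hj, hp, and_comm]
    simp only [hprod, hpar]

theorem double_sum_eq_neg_A_add_B (p : ℕ) (hp : p.Prime) (hp3 : 3 < p)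
    (A B : ZMod p)
    (hA : A = ∑ i ∈ (Finset.Ico 1 p).filter (fun i => Odd i),
        ∑ j ∈ (Finset.Ico 1 i).filter (fun j => Even j), ((i * j : ℕ) : ZMod p)⁻¹)
    (hB : B = ∑ j ∈ (Finset.Ico 1 p).filter (fun j => Even j),
        ∑ i ∈ (Finset.Ico 1 j).filter (fun i => Odd i), ((i * j : ℕ) : ZMod p)⁻¹) :
    ∑ i ∈ Finset.Ico 1 p, ∑ j ∈ Finset.Ico 1 i,
        (-1 : ZMod p) ^ i * ((i * j : ℕ) : ZMod p)⁻¹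
      = -A + B := by
  have hreflect := sum_even_even_eq_sum_odd_odd (hp.odd_of_ne_two (by omega))
  rw [← sub_eq_zero] at hreflect
  rw [← add_zero (-A + B), ← hreflect, hA, hB]
  simp only [Finset.sum_filter]
  simp only [← Finset.sum_neg_distrib, ← Finset.sum_add_distrib, ← Finset.sum_sub_distrib]
  refine Finset.sum_congr rfl fun i _ => ?_
  rcases Nat.even_or_odd i with hi | hi
  · have hi' : ¬ Odd i := Nat.not_odd_iff_even.mpr hi
    simp only [hi, hi', hi.neg_one_pow, if_true, if_false, true_and, false_and, neg_zero, zero_add,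
      sub_zero, one_mul, ← Finset.sum_add_distrib]
    refine Finset.sum_congr rfl fun j _ => ?_
    rcases Nat.even_or_odd j with hj | hj
    · simp [hj, Nat.not_odd_iff_even.mpr hj]
    · simp [hj, Nat.not_even_iff_odd.mpr hj, mul_comm]
  · have hi' : ¬ Even i := Nat.not_even_iff_odd.mpr hi
    simp only [hi, hi', hi.neg_one_pow, if_true, if_false, true_and, false_and, add_zero, zero_sub,
      neg_one_mul, ← Finset.sum_neg_distrib, ← Finset.sum_add_distrib]
    refine Finset.sum_congr rfl fun j _ => ?_
    rcases Nat.even_or_odd j with hj | hj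
    · simp [hj, Nat.not_odd_iff_even.mpr hj]
    · simp [hj, Nat.not_even_iff_odd.mpr hj]
end

section
/- Let p be a prime with p > 3. Then, modulo p, twice the sum of 1/(i·j) over all pairs (i, j) with 0 < i < j < p, i odd and j even, is congruent to the sum of 1/(i·k) over all pairs (i, k) of odd positive integers with i + k < p, where 1/a denotes the multiplicative inverse of a modulo p. -/
/-- Partial fractions: `1 / (i k) = 1 / (i (i + k)) + 1 / (k (i + k))` modulo a prime `p`. -/
theorem ZMod.inv_natCast_mul_eq_add {p : ℕ} [Fact p.Prime] {i k : ℕ}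
    (hi : 0 < i) (hk : 0 < k) (hik : i + k < p) :
    ((i * k : ℕ) : ZMod p)⁻¹
      = ((i * (i + k) : ℕ) : ZMod p)⁻¹ + ((k * (i + k) : ℕ) : ZMod p)⁻¹ := by
  have natCast_ne_zero : ∀ n : ℕ, 0 < n → n < p → (n : ZMod p) ≠ 0 := fun n h0 hn h ↦
    Nat.not_dvd_of_pos_of_lt h0 hn ((ZMod.natCast_eq_zero_iff n p).1 h)
  have hi' := natCast_ne_zero i hi (by omega)
  have hk' := natCast_ne_zero k hk (by omega)
  have hs := natCast_ne_zero (i + k) (by omega) hik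
  push_cast at hs ⊢
  field_simp
  ring

/-- Reindexing pairs of odd numbers `(i, k)` with `i + k < p` by `(j, i) = (i + k, i)`. -/
theorem sum_odd_pairs_add_eq {M : Type*} [AddCommMonoid M] (p : ℕ) (f : ℕ → ℕ → M) :
    ∑ i ∈ (Finset.Ico 1 p).filter (fun i => Odd i),
        ∑ k ∈ (Finset.Ico 1 (p - i)).filter (fun k => Odd k), f i (i + k)
      = ∑ j ∈ (Finset.Ico 1 p).filter (fun j => Even j),
          ∑ i ∈ (Finset.Ico 1 j).filter (fun i => Odd i), f i j := by
  rw [Finset.sum_sigma', Finset.sum_sigma']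
  refine Finset.sum_bij' (fun x _ ↦ ⟨x.1 + x.2, x.1⟩) (fun x _ ↦ ⟨x.2, x.1 - x.2⟩)
    ?_ ?_ ?_ ?_ ?_
  · rintro ⟨i, k⟩ h
    simp only [Finset.mem_sigma, Finset.mem_filter, Finset.mem_Ico] at h ⊢
    grind
  · rintro ⟨j, i⟩ h
    simp only [Finset.mem_sigma, Finset.mem_filter, Finset.mem_Ico] at h ⊢
    grind
  · rintro ⟨i, k⟩ _
    simp
  · rintro ⟨j, i⟩ h
    simp only [Finset.mem_sigma, Finset.mem_filter, Finset.mem_Ico] at h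
    simp [Nat.add_sub_cancel' h.2.1.2.le]
  · simp

/-- Exchanging the roles of `i` and `k` in a sum over odd pairs with `i + k < p`. -/
theorem sum_odd_pairs_comm {M : Type*} [AddCommMonoid M] (p : ℕ) (f : ℕ → ℕ → M) :
    ∑ i ∈ (Finset.Ico 1 p).filter (fun i => Odd i),
        ∑ k ∈ (Finset.Ico 1 (p - i)).filter (fun k => Odd k), f i k
      = ∑ i ∈ (Finset.Ico 1 p).filter (fun i => Odd i),
          ∑ k ∈ (Finset.Ico 1 (p - i)).filter (fun k => Odd k), f k i := by
  refine Finset.sum_comm' fun i k ↦ ?_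
  simp only [Finset.mem_filter, Finset.mem_Ico]
  grind

theorem two_mul_sum_eq_odd_pairs (p : ℕ) (hp : p.Prime) (hp3 : 3 < p) :
    2 * ∑ j ∈ (Finset.Ico 1 p).filter (fun j => Even j),
          ∑ i ∈ (Finset.Ico 1 j).filter (fun i => Odd i), ((i * j : ℕ) : ZMod p)⁻¹
      = ∑ i ∈ (Finset.Ico 1 p).filter (fun i => Odd i),
          ∑ k ∈ (Finset.Ico 1 (p - i)).filter (fun k => Odd k), ((i * k : ℕ) : ZMod p)⁻¹ := by
  have : Fact p.Prime := ⟨hp⟩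
  symm
  calc
    _ = ∑ i ∈ (Finset.Ico 1 p).filter (fun i => Odd i),
          ∑ k ∈ (Finset.Ico 1 (p - i)).filter (fun k => Odd k),
            (((i * (i + k) : ℕ) : ZMod p)⁻¹ + ((k * (i + k) : ℕ) : ZMod p)⁻¹) := by
      refine Finset.sum_congr rfl fun i hi ↦ Finset.sum_congr rfl fun k hk ↦ ?_
      simp only [Finset.mem_filter, Finset.mem_Ico] at hi hk
      exact ZMod.inv_natCast_mul_eq_add (by omega) (by omega) (by omega)
    _ = _ := by
      simp only [Finset.sum_add_distrib]
      rw [sum_odd_pairs_comm p fun i k ↦ ((k * (i + k) : ℕ) : ZMod p)⁻¹]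
      simp only [fun i k : ℕ ↦ add_comm k i]
      rw [sum_odd_pairs_add_eq p fun i j ↦ ((i * j : ℕ) : ZMod p)⁻¹, two_mul]
end

section
/- Let p be a prime with p > 3, and write g(-1) = Σ_{i=1}^{p-1} (-1)^i / i, where 1/a denotes the multiplicative inverse of a modulo p^3. Then, modulo p^3, 2^(2p-2) is congruent to 1 - p·g(-1) + (p^2/2)·g(-1)^2, where 1/2 denotes the inverse of 2 modulo p^3. -/
open Finset in
theorem sum_sum_neg_one_pow_mul_inv_eq_sq (p : ℕ) [Fact p.Prime] (hp3 : 3 < p) :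
    4 * ∑ n ∈ Ico 1 p, (-1 : ZMod p) ^ n * (n : ZMod p)⁻¹ * ∑ a ∈ Ico 1 n, (a : ZMod p)⁻¹
      = (∑ n ∈ Ico 1 p, (-1 : ZMod p) ^ n * (n : ZMod p)⁻¹) ^ 2 := by
  have hodd : Odd p := (Fact.out : p.Prime).odd_of_ne_two (by omega)
  have hne : ∀ n ∈ Ico 1 p, (n : ZMod p) ≠ 0 := fun n hn h0 ↦ by
    rw [ZMod.natCast_eq_zero_iff] at h0
    have := Nat.le_of_dvd (by grind) h0
    grind
  have hrefl : ∀ n ∈ Ico 1 p, ((p - n : ℕ) : ZMod p) = -n := fun n hn ↦ by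
    rw [Nat.cast_sub (by grind)]; simp
  have hinvsq : ∑ n ∈ Ico 1 p, ((n : ZMod p)⁻¹) ^ 2 = 0 := by
    have hcard : p - 3 < Fintype.card (ZMod p) - 1 := by
      rw [ZMod.card]; omega
    rw [← FiniteField.sum_pow_lt_card_sub_one (ZMod p) (p - 3) hcard]
    have h0 : ∑ x : ZMod p, x ^ (p - 3) = ∑ n ∈ range p, (n : ZMod p) ^ (p - 3) := by
      symm
      refine sum_nbij' (fun n ↦ (n : ZMod p)) (fun x ↦ x.val) (by simp) ?_ ?_ (by simp) (by simp)
      · intro x _; simpa using ZMod.val_lt x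
      · intro n hn; exact ZMod.val_cast_of_lt (by simpa using hn)
    rw [h0, range_eq_Ico, sum_eq_sum_Ico_succ_bot (a := 0) (by omega)]
    rw [Nat.cast_zero, zero_pow (by omega), zero_add]
    refine sum_congr rfl fun n hn ↦ ?_
    have h1 := ZMod.pow_card_sub_one_eq_one (hne n hn)
    rw [show p - 1 = p - 3 + 2 by omega, pow_add] at h1
    have := hne n hn
    field_simp
    rw [mul_comm, h1]
  set F : ℕ × ℕ → ZMod p := fun x ↦ (-1) ^ (x.1 + x.2) * ((x.1 : ZMod p)⁻¹ * (x.2 : ZMod p)⁻¹)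
    with hF
  set P := Ico 1 p ×ˢ Ico 1 p with hP
  have hsq : (∑ n ∈ Ico 1 p, (-1 : ZMod p) ^ n * (n : ZMod p)⁻¹) ^ 2 = ∑ x ∈ P, F x := by
    rw [sq, sum_mul_sum, hP, sum_product]
    refine sum_congr rfl fun a _ ↦ sum_congr rfl fun b _ ↦ ?_
    simp only [hF, pow_add]; ring
  have hdiag : ∑ x ∈ P with x.1 + x.2 = p, F x = 0 := by
    rw [← hinvsq]
    refine sum_nbij' (fun x ↦ x.1) (fun n ↦ (n, p - n)) ?_ ?_ ?_ ?_ ?_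
    · intro x hx; grind
    · intro n hn; grind
    · rintro ⟨a, b⟩ hx; simp at hx ⊢; omega
    · intro n hn; rfl
    · rintro ⟨a, b⟩ hx
      have ha : a ∈ Ico 1 p := by grind
      have hb : b = p - a := by grind
      simp only [mem_filter] at hx
      simp only [hF, hx.2, hodd.neg_one_pow]
      rw [hb, hrefl a ha, inv_neg]; ring
  have habove : ∑ x ∈ P with p < x.1 + x.2, F x = ∑ x ∈ P with x.1 + x.2 < p, F x := by
    refine sum_nbij' (fun x ↦ (p - x.1, p - x.2)) (fun x ↦ (p - x.1, p - x.2)) ?_ ?_ ?_ ?_ ?_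
    · intro x hx; grind
    · intro x hx; grind
    · rintro ⟨a, b⟩ hx; simp [hP] at hx ⊢; omega
    · rintro ⟨a, b⟩ hx; simp [hP] at hx ⊢; omega
    · rintro ⟨a, b⟩ hx
      have ha : a ∈ Ico 1 p := by grind
      have hb : b ∈ Ico 1 p := by grind
      simp only [hF]
      rw [hrefl a ha, hrefl b hb, inv_neg, inv_neg, neg_mul_neg]
      congr 1
      apply neg_one_pow_congr
      grind
  have hsplit : ∑ x ∈ P, F x = 2 * ∑ x ∈ P with x.1 + x.2 < p, F x := by
    rw [← sum_filter_add_sum_filter_not P (fun x ↦ x.1 + x.2 < p) F,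
      ← sum_filter_add_sum_filter_not (P.filter fun x ↦ ¬ x.1 + x.2 < p) (fun x ↦ x.1 + x.2 = p) F,
      filter_filter, filter_filter]
    rw [show (P.filter fun x ↦ ¬ x.1 + x.2 < p ∧ x.1 + x.2 = p) = P.filter fun x ↦ x.1 + x.2 = p
        from filter_congr fun x _ ↦ by omega,
      show (P.filter fun x ↦ ¬ x.1 + x.2 < p ∧ ¬ x.1 + x.2 = p) = P.filter fun x ↦ p < x.1 + x.2
        from filter_congr fun x _ ↦ by omega, hdiag, habove]
    ring
  set K : ℕ × ℕ → ZMod p :=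
    fun x ↦ (-1) ^ (x.1 + x.2) * (((x.1 + x.2 : ℕ) : ZMod p)⁻¹ * (x.1 : ZMod p)⁻¹) with hK
  have hswap : ∑ x ∈ P with x.1 + x.2 < p, K x.swap = ∑ x ∈ P with x.1 + x.2 < p, K x := by
    refine sum_nbij' Prod.swap Prod.swap ?_ ?_ ?_ ?_ ?_
    · intro x hx; grind
    · intro x hx; grind
    · intro x _; simp
    · intro x _; simp
    · intro x _; rfl
  have hpartial : ∑ x ∈ P with x.1 + x.2 < p, F x = 2 * ∑ x ∈ P with x.1 + x.2 < p, K x := by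
    rw [two_mul]
    nth_rewrite 1 [← hswap]
    rw [← sum_add_distrib]
    refine sum_congr rfl ?_
    rintro ⟨a, b⟩ hx
    have ha := hne a (by grind)
    have hb := hne b (by grind)
    have hab := hne (a + b) (by grind)
    simp only [hF, hK, Prod.swap]
    rw [add_comm b a]
    push_cast at hab ⊢
    field_simp
  have htri : ∑ x ∈ P with x.1 + x.2 < p, K x
      = ∑ n ∈ Ico 1 p, (-1 : ZMod p) ^ n * (n : ZMod p)⁻¹ * ∑ a ∈ Ico 1 n, (a : ZMod p)⁻¹ := by
    simp_rw [mul_sum]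
    rw [sum_sigma']
    refine sum_nbij' (fun x ↦ ⟨x.1 + x.2, x.1⟩) (fun y ↦ (y.2, y.1 - y.2)) ?_ ?_ ?_ ?_ ?_
    · intro x hx; simp [hP] at hx ⊢; omega
    · intro x hx; simp [hP] at hx ⊢; omega
    · intro x hx; simp
    · rintro ⟨n, a⟩ hx
      simp at hx ⊢; omega
    · intro x hx; simp only [hK]; ring
  rw [hsq, hsplit, hpartial, htri]
  ring

theorem natCast_mul_inv_of_mem_Ico {p : ℕ} (hp : p.Prime) (k : ℕ) {n : ℕ}
    (hn : n ∈ Finset.Ico 1 p) : (n : ZMod (p ^ k)) * (n : ZMod (p ^ k))⁻¹ = 1 := by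
  rw [Finset.mem_Ico] at hn
  exact ZMod.coe_mul_inv_eq_one n
    ((Nat.coprime_of_lt_prime (by omega) hn.2 hp).symm.pow_right k)

theorem natCast_prime_pow_three_eq_zero (p : ℕ) : (p : ZMod (p ^ 3)) ^ 3 = 0 := by
  exact_mod_cast ZMod.natCast_self (p ^ 3)

open Finset in
theorem prime_mul_choose_prime_sub_one {p : ℕ} (hp : p.Prime) (k : ℕ) (hk : k < p) :
    (p : ZMod (p ^ 3)) * ((p - 1).choose k : ℕ)
      = (-1) ^ k * (p - p ^ 2 * ∑ j ∈ Ico 1 (k + 1), (j : ZMod (p ^ 3))⁻¹) := by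
  induction k with
  | zero => simp
  | succ k ih =>
    have hu := natCast_mul_inv_of_mem_Ico hp 3 (n := k + 1) (by grind)
    have hp0 := natCast_prime_pow_three_eq_zero p
    have hrec : (((p - 1).choose (k + 1) : ℕ) : ZMod (p ^ 3)) * ((k + 1 : ℕ) : ZMod (p ^ 3))
        = ((p - 1).choose k : ℕ) * (p - ((k + 1 : ℕ) : ZMod (p ^ 3))) := by
      rw [← Nat.cast_sub hk.le, ← Nat.cast_mul, ← Nat.cast_mul, Nat.choose_succ_right_eq,
        show p - 1 - k = p - (k + 1) by omega]
    have ih := ih (by omega)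
    rw [sum_Ico_succ_top (by omega)]
    set u := ((k + 1 : ℕ) : ZMod (p ^ 3))
    set H := ∑ j ∈ Ico 1 (k + 1), (j : ZMod (p ^ 3))⁻¹
    set c := (((p - 1).choose k : ℕ) : ZMod (p ^ 3))
    set d := (((p - 1).choose (k + 1) : ℕ) : ZMod (p ^ 3))
    set q := (p : ZMod (p ^ 3))
    rw [pow_succ (-1 : ZMod (p ^ 3))]
    linear_combination (-q * d) * hu + q * u⁻¹ * hrec + u⁻¹ * (q - u) * ih
      - (-1) ^ k * (q - q ^ 2 * H) * hu - (-1) ^ k * u⁻¹ * H * hp0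

open Finset in
theorem two_pow_prime_eq {p : ℕ} (hp : p.Prime) :
    (2 : ZMod (p ^ 3)) ^ p = 2 - p * ∑ n ∈ Ico 1 p, (-1) ^ n * (n : ZMod (p ^ 3))⁻¹
      + p ^ 2 * ∑ n ∈ Ico 1 p,
          (-1) ^ n * (n : ZMod (p ^ 3))⁻¹ * ∑ a ∈ Ico 1 n, (a : ZMod (p ^ 3))⁻¹ := by
  have hsum : (2 : ZMod (p ^ 3)) ^ p = ∑ n ∈ range (p + 1), ((p.choose n : ℕ) : ZMod (p ^ 3)) := by
    rw [← Nat.cast_sum, Nat.sum_range_choose]; simp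
  rw [hsum, sum_range_succ, range_eq_Ico, sum_eq_sum_Ico_succ_bot hp.pos, Nat.choose_zero_right,
    Nat.choose_self, mul_sum, mul_sum]
  have hterm : ∀ n ∈ Ico 1 p, ((p.choose n : ℕ) : ZMod (p ^ 3))
      = -(p * ((-1) ^ n * (n : ZMod (p ^ 3))⁻¹))
        + p ^ 2 * ((-1) ^ n * (n : ZMod (p ^ 3))⁻¹ * ∑ a ∈ Ico 1 n, (a : ZMod (p ^ 3))⁻¹) := by
    intro n hn
    obtain ⟨k, rfl⟩ : ∃ k, n = k + 1 := ⟨n - 1, by grind⟩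
    have hu := natCast_mul_inv_of_mem_Ico hp 3 hn
    have hc := prime_mul_choose_prime_sub_one hp k (by grind)
    have hrec : (p : ZMod (p ^ 3)) * ((p - 1).choose k : ℕ)
        = (p.choose (k + 1) : ℕ) * ((k + 1 : ℕ) : ZMod (p ^ 3)) := by
      have := Nat.add_one_mul_choose_eq (p - 1) k
      rw [Nat.sub_add_cancel hp.one_le] at this
      exact_mod_cast congrArg (Nat.cast : ℕ → ZMod (p ^ 3)) this
    set u := ((k + 1 : ℕ) : ZMod (p ^ 3))
    rw [pow_succ (-1 : ZMod (p ^ 3))]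
    linear_combination (-((p.choose (k + 1) : ℕ) : ZMod (p ^ 3))) * hu - u⁻¹ * hrec + u⁻¹ * hc
  rw [sum_congr rfl hterm, sum_add_distrib, sum_neg_distrib]
  push_cast
  ring

theorem sq_mul_eq_zero_of_castHom_eq_zero {p : ℕ} (hp : p.Prime) (x : ZMod (p ^ 3))
    (hx : ZMod.castHom (dvd_pow_self p three_ne_zero) (ZMod p) x = 0) :
    (p : ZMod (p ^ 3)) ^ 2 * x = 0 := by
  have : NeZero (p ^ 3) := ⟨pow_ne_zero 3 hp.ne_zero⟩
  obtain ⟨n, rfl⟩ := ZMod.natCast_zmod_surjective x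
  rw [map_natCast, ZMod.natCast_eq_zero_iff] at hx
  obtain ⟨m, rfl⟩ := hx
  push_cast
  linear_combination (m : ZMod (p ^ 3)) * natCast_prime_pow_three_eq_zero p

theorem castHom_natCast_inv {p : ℕ} (hp : p.Prime) {n : ℕ} (hn : n ∈ Finset.Ico 1 p) :
    ZMod.castHom (dvd_pow_self p three_ne_zero) (ZMod p) (n : ZMod (p ^ 3))⁻¹
      = (n : ZMod p)⁻¹ := by
  have : Fact p.Prime := ⟨hp⟩
  have h := congrArg (ZMod.castHom (dvd_pow_self p three_ne_zero) (ZMod p))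
    (natCast_mul_inv_of_mem_Ico hp 3 hn)
  rw [map_mul, map_one, map_natCast] at h
  exact eq_inv_of_mul_eq_one_right h

open Finset in
theorem sq_mul_sum_sum_neg_one_pow_mul_inv {p : ℕ} (hp : p.Prime) (hp3 : 3 < p) :
    (p : ZMod (p ^ 3)) ^ 2 * (4 * ∑ n ∈ Ico 1 p,
        (-1) ^ n * (n : ZMod (p ^ 3))⁻¹ * ∑ a ∈ Ico 1 n, (a : ZMod (p ^ 3))⁻¹
      - (∑ n ∈ Ico 1 p, (-1) ^ n * (n : ZMod (p ^ 3))⁻¹) ^ 2) = 0 := by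
  have : Fact p.Prime := ⟨hp⟩
  apply sq_mul_eq_zero_of_castHom_eq_zero hp
  rw [map_sub, sub_eq_zero, map_pow, map_sum, map_mul, map_sum]
  convert sum_sum_neg_one_pow_mul_inv_eq_sq p hp3 using 2
  · rw [map_ofNat]
  · refine sum_congr rfl fun n hn ↦ ?_
    rw [map_mul, map_mul, map_sum, castHom_natCast_inv hp hn, map_pow, map_neg, map_one]
    congr 1
    exact sum_congr rfl fun a ha ↦ castHom_natCast_inv hp (by grind)
  · refine sum_congr rfl fun n hn ↦ ?_
    rw [map_mul, castHom_natCast_inv hp hn, map_pow, map_neg, map_one]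

theorem two_pow_sq_via_g (p : ℕ) (hp : p.Prime) (hp3 : 3 < p)
    (g : ZMod (p ^ 3))
    (hg : g = ∑ i ∈ Finset.Icc 1 (p - 1), (-1 : ZMod (p ^ 3)) ^ i * (i : ZMod (p ^ 3))⁻¹) :
    (2 : ZMod (p ^ 3)) ^ (2 * p - 2)
      = 1 - (p : ZMod (p ^ 3)) * g + (p : ZMod (p ^ 3)) ^ 2 * (2 : ZMod (p ^ 3))⁻¹ * g ^ 2 := by
  have hIcc : Finset.Icc 1 (p - 1) = Finset.Ico 1 p := by grind
  have hpow := two_pow_prime_eq hp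
  have hT := sq_mul_sum_sum_neg_one_pow_mul_inv hp hp3
  have hp0 := natCast_prime_pow_three_eq_zero p
  have h2 : (2 : ZMod (p ^ 3)) * 2⁻¹ = 1 := by
    exact_mod_cast natCast_mul_inv_of_mem_Ico hp 3 (n := 2) (by grind)
  rw [hIcc] at hg
  rw [← hg] at hpow hT
  set T := ∑ n ∈ Finset.Ico 1 p,
    (-1) ^ n * (n : ZMod (p ^ 3))⁻¹ * ∑ a ∈ Finset.Ico 1 n, (a : ZMod (p ^ 3))⁻¹
  have hunit : IsUnit (4 : ZMod (p ^ 3)) :=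
    .of_mul_eq_one (2⁻¹ * 2⁻¹) (by linear_combination (2 * 2⁻¹ + 1) * h2)
  refine hunit.mul_left_cancel ?_
  have hsq : (4 : ZMod (p ^ 3)) * 2 ^ (2 * p - 2) = (2 ^ p) ^ 2 := by
    rw [← pow_mul, show p * 2 = 2 * p - 2 + 2 by have := hp.two_le; omega, pow_add]; ring
  rw [hsq, hpow]
  linear_combination hT - 2 * (p : ZMod (p ^ 3)) ^ 2 * g ^ 2 * h2
    + (-2 * g * T + p * T ^ 2) * hp0
end

section
/- Let p be a prime with p > 3, let q be the integer (2^(p-1) - 1)/p (the Fermat quotient of 2), and write g(-1) = Σ_{i=1}^{p-1} (-1)^i / i, where 1/a denotes the multiplicative inverse of a modulo p^2. Then 2q ≡ -g(-1) + q^2·p (mod p^2). -/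
open Finset

namespace FermatQuotient

theorem natCast_mul_inv_cancel {p i n : ℕ} (hp : p.Prime) (h1 : 1 ≤ i) (h2 : i < p) :
    (i : ZMod (p ^ n)) * (i : ZMod (p ^ n))⁻¹ = 1 :=
  ZMod.coe_mul_inv_eq_one i (Nat.Coprime.pow_right n (Nat.coprime_of_lt_prime (by omega) h2 hp).symm)

theorem natCast_ne_zero {p i : ℕ} (h1 : 1 ≤ i) (h2 : i < p) : (i : ZMod p) ≠ 0 := by
  rw [Ne, ZMod.natCast_eq_zero_iff]
  exact Nat.not_dvd_of_pos_of_lt h1 h2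

theorem sq_natCast_eq_zero (p : ℕ) : (p : ZMod (p ^ 2)) ^ 2 = 0 := by
  exact_mod_cast ZMod.natCast_self (p ^ 2)

/-- Modulo `p ^ 2`, `(p - 1).choose k` is `(-1) ^ k` times `1 - p * H_k`, with `H_k` the
harmonic sum. -/
theorem choose_pred_eq {p : ℕ} (hp : p.Prime) (k : ℕ) (hk : k < p) :
    ((p - 1).choose k : ZMod (p ^ 2)) =
      (-1) ^ k * (1 - p * ∑ j ∈ Icc 1 k, (j : ZMod (p ^ 2))⁻¹) := by
  induction k with
  | zero => simp
  | succ k ih =>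
    have h := ih (by omega)
    have hinv := natCast_mul_inv_cancel (n := 2) hp (Nat.succ_pos k) hk
    have hsucc : ((p - 1).choose (k + 1) : ZMod (p ^ 2)) * ((k + 1 : ℕ) : ZMod (p ^ 2)) =
        (p - 1).choose k * (p - (k + 1 : ℕ)) := by
      rw [← Nat.cast_sub hk.le, ← Nat.cast_mul, ← Nat.cast_mul, Nat.choose_succ_right_eq,
        Nat.sub_sub, Nat.add_comm 1 k]
    have hsq := sq_natCast_eq_zero p
    rw [sum_Icc_succ_top (by omega), pow_succ (-1 : ZMod (p ^ 2))]
    rw [h] at hsucc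
    generalize ((k + 1 : ℕ) : ZMod (p ^ 2)) = a at *
    generalize a⁻¹ = b at *
    generalize (∑ j ∈ Icc 1 k, (j : ZMod (p ^ 2))⁻¹) = H at *
    generalize (p : ZMod (p ^ 2)) = P at *
    generalize ((p - 1).choose (k + 1) : ZMod (p ^ 2)) = c at *
    generalize (-1 : ZMod (p ^ 2)) ^ k = e at *
    linear_combination b * hsucc - (c + e * (1 - P * H)) * hinv - e * b * H * hsq

theorem sum_inv_sq_eq_zero {p : ℕ} (hp : p.Prime) (hp3 : 3 < p) :
    ∑ i ∈ Icc 1 (p - 1), (i : ZMod p)⁻¹ * (i : ZMod p)⁻¹ = 0 := by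
  have := Fact.mk hp
  have h : ∑ x : ZMod p, x ^ 2 = 0 :=
    FiniteField.sum_pow_lt_card_sub_one (ZMod p) 2 (by rw [ZMod.card]; omega)
  rw [← Equiv.sum_comp (Equiv.inv (ZMod p)), ← sum_erase univ (a := (0 : ZMod p)) (by simp)] at h
  rw [← h]
  refine sum_bij' (fun i _ => (i : ZMod p)) (fun x _ => x.val) ?_ ?_ ?_ ?_ ?_
  · intro i hi
    rw [mem_Icc] at hi
    simpa using natCast_ne_zero (p := p) hi.1 (by omega)
  · intro x hx
    have := x.val_lt
    have : x.val ≠ 0 := by simpa using hx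
    rw [mem_Icc]
    omega
  · intro i hi
    rw [mem_Icc] at hi
    exact ZMod.val_cast_of_lt (by omega)
  · intro x _
    simp
  · intro i _
    simp [sq]

theorem neg_one_pow_sub {R : Type*} [CommRing R] {p i : ℕ} (hp : Odd p) (hi : i ≤ p) :
    (-1 : R) ^ (p - i) = -(-1) ^ i := by
  have h : (-1 : R) ^ (p - i) * (-1) ^ i = -1 := by
    rw [← pow_add, Nat.sub_add_cancel hi, hp.neg_one_pow]
  have hs : (-1 : R) ^ i * (-1) ^ i = 1 := by
    rw [← mul_pow]; simp
  linear_combination (-1 : R) ^ i * h - (-1 : R) ^ (p - i) * hs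

/-- The square of the alternating harmonic sum modulo `p`. -/
theorem alternating_sum_sq {p : ℕ} (hp : p.Prime) (hp3 : 3 < p) :
    (∑ i ∈ Icc 1 (p - 1), (-1) ^ i * (i : ZMod p)⁻¹) ^ 2 =
      4 * ∑ i ∈ Icc 1 (p - 1), (-1) ^ i * (i : ZMod p)⁻¹ *
        ∑ j ∈ Icc 1 (i - 1), (j : ZMod p)⁻¹ := by
  have := Fact.mk hp
  have hodd : Odd p := hp.odd_of_ne_two (by omega)
  set s := Icc 1 (p - 1) ×ˢ Icc 1 (p - 1) with hs
  have mem_s (x : ℕ × ℕ) : x ∈ s ↔ (1 ≤ x.1 ∧ x.1 ≤ p - 1) ∧ 1 ≤ x.2 ∧ x.2 ≤ p - 1 := by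
    simp [hs]
  set f : ℕ × ℕ → ZMod p := fun x => (-1) ^ x.1 * (x.1 : ZMod p)⁻¹ * ((-1) ^ x.2 * (x.2 : ZMod p)⁻¹)
    with hf
  have cast_sub_inv {i : ℕ} (hi : i ≤ p) : ((p - i : ℕ) : ZMod p)⁻¹ = -(i : ZMod p)⁻¹ := by
    rw [Nat.cast_sub hi, ZMod.natCast_self, zero_sub, inv_neg]
  have hsplit : (∑ i ∈ Icc 1 (p - 1), (-1) ^ i * (i : ZMod p)⁻¹) ^ 2 =
      ∑ x ∈ s with x.1 + x.2 < p, f x +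
        (∑ x ∈ s with p < x.1 + x.2, f x + ∑ x ∈ s with x.1 + x.2 = p, f x) := by
    rw [sq, sum_mul_sum, ← sum_product', ← sum_filter_add_sum_filter_not _ (fun x => x.1 + x.2 < p),
      ← sum_filter_add_sum_filter_not ({x ∈ s | ¬ x.1 + x.2 < p}) (fun x => p < x.1 + x.2)]
    rw [filter_filter, filter_filter]
    congr 2
    · congr 1; ext x; simp only [mem_filter, mem_s]; omega
    · congr 1; ext x; simp only [mem_filter, mem_s]; omega
  have hgt : ∑ x ∈ s with p < x.1 + x.2, f x = ∑ x ∈ s with x.1 + x.2 < p, f x := by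
    refine sum_nbij' (fun x => (p - x.1, p - x.2)) (fun x => (p - x.1, p - x.2)) ?_ ?_ ?_ ?_ ?_
    · intro x; simp only [mem_filter, mem_s]; omega
    · intro x; simp only [mem_filter, mem_s]; omega
    · rintro ⟨i, j⟩; simp only [mem_filter, mem_s, Prod.mk.injEq]; omega
    · rintro ⟨i, j⟩; simp only [mem_filter, mem_s, Prod.mk.injEq]; omega
    · rintro ⟨i, j⟩ hx
      simp only [mem_filter, mem_s] at hx
      have hi : i ≤ p := by omega
      have hj : j ≤ p := by omega
      simp only [hf, neg_one_pow_sub hodd hi, neg_one_pow_sub hodd hj, cast_sub_inv hi,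
        cast_sub_inv hj]
      ring
  have heq : ∑ x ∈ s with x.1 + x.2 = p, f x = 0 := by
    rw [← sum_inv_sq_eq_zero hp hp3]
    refine sum_nbij' (fun x => x.1) (fun i => (i, p - i)) ?_ ?_ ?_ ?_ ?_
    · intro x; simp only [mem_filter, mem_s, mem_Icc]; omega
    · intro x; simp only [mem_filter, mem_s, mem_Icc]; omega
    · rintro ⟨i, j⟩; simp only [mem_filter, mem_s, Prod.mk.injEq, true_and]; omega
    · intro i _; rfl
    · rintro ⟨i, j⟩ hx
      simp only [mem_filter, mem_s] at hx
      have hi : i ≤ p := by omega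
      obtain rfl : j = p - i := by omega
      have h1 : (-1 : ZMod p) ^ i * (-1) ^ i = 1 := by rw [← mul_pow]; simp
      simp only [hf, neg_one_pow_sub hodd hi, cast_sub_inv hi]
      linear_combination (i : ZMod p)⁻¹ * (i : ZMod p)⁻¹ * h1
  set t : ℕ × ℕ → ZMod p := fun x => (-1) ^ (x.1 + x.2) * ((x.1 + x.2 : ℕ) : ZMod p)⁻¹ *
    (x.2 : ZMod p)⁻¹ with ht
  have hswap : ∑ x ∈ s with x.1 + x.2 < p, t x.swap = ∑ x ∈ s with x.1 + x.2 < p, t x := by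
    refine sum_nbij' Prod.swap Prod.swap ?_ ?_ ?_ ?_ ?_
    · intro x; simp only [mem_filter, mem_s, Prod.fst_swap, Prod.snd_swap]; omega
    · intro x; simp only [mem_filter, mem_s, Prod.fst_swap, Prod.snd_swap]; omega
    · intro x _; simp
    · intro x _; simp
    · intro x _; rfl
  have hft : ∑ x ∈ s with x.1 + x.2 < p, f x = 2 * ∑ x ∈ s with x.1 + x.2 < p, t x := by
    rw [two_mul]
    nth_rw 1 [← hswap]
    rw [← sum_add_distrib]
    refine sum_congr rfl ?_
    rintro ⟨i, j⟩ hx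
    simp only [mem_filter, mem_s] at hx
    have hi := natCast_ne_zero (p := p) hx.1.1.1 (by omega)
    have hj := natCast_ne_zero (p := p) hx.1.2.1 (by omega)
    have hij := natCast_ne_zero (p := p) (i := i + j) (by omega) (by omega)
    simp only [hf, ht, Prod.swap, Nat.add_comm j i]
    push_cast at hij ⊢
    rw [pow_add]
    field_simp
    ring
  have hreindex : ∑ x ∈ s with x.1 + x.2 < p, t x = ∑ i ∈ Icc 1 (p - 1),
      (-1) ^ i * (i : ZMod p)⁻¹ * ∑ j ∈ Icc 1 (i - 1), (j : ZMod p)⁻¹ := by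
    simp_rw [mul_sum]
    rw [sum_sigma']
    refine sum_nbij' (fun x => ⟨x.1 + x.2, x.2⟩) (fun x => (x.1 - x.2, x.2)) ?_ ?_ ?_ ?_ ?_
    · intro x; simp only [mem_filter, mem_s, mem_sigma, mem_Icc]; omega
    · intro x; simp only [mem_filter, mem_s, mem_sigma, mem_Icc]; omega
    · rintro ⟨i, j⟩ _; simp
    · rintro ⟨i, j⟩ hx
      simp only [mem_sigma, mem_Icc] at hx
      have h : i - j + j = i := by omega
      simp [h]
    · intro x _; rfl
  rw [hsplit, hgt, heq, hft, hreindex]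
  ring

theorem natCast_mul_eq_of_castHom_eq {p : ℕ} {x y : ZMod (p ^ 2)}
    (h : ZMod.castHom (dvd_pow_self p two_ne_zero) (ZMod p) x =
      ZMod.castHom (dvd_pow_self p two_ne_zero) (ZMod p) y) :
    (p : ZMod (p ^ 2)) * x = p * y := by
  obtain ⟨a, rfl⟩ := ZMod.intCast_surjective x
  obtain ⟨b, rfl⟩ := ZMod.intCast_surjective y
  rw [map_intCast, map_intCast, ZMod.intCast_eq_intCast_iff_dvd_sub] at h
  obtain ⟨c, hc⟩ := h
  have hb : b = a + p * c := by linarith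
  subst hb
  push_cast
  linear_combination -(c : ZMod (p ^ 2)) * sq_natCast_eq_zero p

theorem castHom_natCast_inv {p i : ℕ} (hp : p.Prime) (h1 : 1 ≤ i) (h2 : i < p) :
    ZMod.castHom (dvd_pow_self p two_ne_zero) (ZMod p) (i : ZMod (p ^ 2))⁻¹ = (i : ZMod p)⁻¹ := by
  have := Fact.mk hp
  refine eq_inv_of_mul_eq_one_right ?_
  rw [← map_natCast (ZMod.castHom (dvd_pow_self p two_ne_zero) (ZMod p)), ← map_mul,
    natCast_mul_inv_cancel hp h1 h2, map_one]

/-- Twice the Fermat quotient modulo `p ^ 2`, from the binomial expansion of `2 ^ p`. -/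
theorem two_mul_quotient_eq {p : ℕ} (hp : p.Prime) {q : ℤ}
    (hq : (p : ℤ) * q = 2 ^ (p - 1) - 1) :
    2 * (q : ZMod (p ^ 2)) =
      -(∑ i ∈ Icc 1 (p - 1), (-1) ^ i * (i : ZMod (p ^ 2))⁻¹) +
        p * ∑ i ∈ Icc 1 (p - 1), (-1) ^ i * (i : ZMod (p ^ 2))⁻¹ *
          ∑ j ∈ Icc 1 (i - 1), (j : ZMod (p ^ 2))⁻¹ := by
  have hp1 := hp.one_lt
  have hdvd (i : ℕ) (hi : i ∈ Icc 1 (p - 1)) : p * (p.choose i / p) = p.choose i := by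
    rw [mem_Icc] at hi
    exact Nat.mul_div_cancel' (hp.dvd_choose_self (by omega) (by omega))
  have hsum : (2 : ℤ) * q = ∑ i ∈ Icc 1 (p - 1), ((p.choose i / p : ℕ) : ℤ) := by
    have hp0 : (p : ℤ) ≠ 0 := by exact_mod_cast hp.ne_zero
    refine mul_left_cancel₀ hp0 ?_
    have h2 : (∑ i ∈ Icc 1 (p - 1), p.choose i) + 2 = 2 ^ p := by
      rw [← Nat.sum_range_choose, sum_range_succ, sum_range_eq_add_Ico _ hp.pos]
      have : Icc 1 (p - 1) = Ico 1 p := by ext; simp only [mem_Icc, mem_Ico]; omega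
      rw [this]
      simp
      ring
    rw [mul_sum]
    have h3 : ∑ i ∈ Icc 1 (p - 1), (p : ℤ) * ((p.choose i / p : ℕ) : ℤ) =
        ∑ i ∈ Icc 1 (p - 1), (p.choose i : ℤ) :=
      sum_congr rfl fun i hi => by exact_mod_cast hdvd i hi
    have h4 : (2 : ℤ) ^ p = 2 * 2 ^ (p - 1) := by
      rw [← pow_succ', Nat.sub_add_cancel hp1.le]
    zify at h2
    rw [h3]
    linear_combination 2 * hq - h2 - h4
  have hcast := congrArg (Int.cast : ℤ → ZMod (p ^ 2)) hsum
  rw [Int.cast_mul, Int.cast_sum] at hcast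
  simp only [Int.cast_natCast, Int.cast_ofNat] at hcast
  rw [hcast, mul_sum, ← sum_neg_distrib, ← sum_add_distrib]
  refine sum_congr rfl fun i hi => ?_
  have hd := hdvd i hi
  rw [mem_Icc] at hi
  obtain ⟨k, rfl⟩ : ∃ k, i = k + 1 := ⟨i - 1, by omega⟩
  have hmul : (k + 1) * (p.choose (k + 1) / p) = (p - 1).choose k := by
    refine Nat.eq_of_mul_eq_mul_left hp.pos ?_
    have := Nat.add_one_mul_choose_eq (p - 1) k
    rw [Nat.sub_add_cancel hp1.le] at this
    rw [this, ← mul_assoc, mul_comm p, mul_assoc, hd, mul_comm]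
  have hmul' := congrArg (Nat.cast : ℕ → ZMod (p ^ 2)) hmul
  rw [Nat.cast_mul, choose_pred_eq hp k (by omega)] at hmul'
  have hinv := natCast_mul_inv_cancel (n := 2) hp hi.1 (by omega)
  rw [Nat.add_sub_cancel, pow_succ (-1 : ZMod (p ^ 2))]
  linear_combination ((k + 1 : ℕ) : ZMod (p ^ 2))⁻¹ * hmul' -
    ((p.choose (k + 1) / p : ℕ) : ZMod (p ^ 2)) * hinv

end FermatQuotient

open FermatQuotient

theorem fermat_quotient_identity (p : ℕ) (hp : p.Prime) (hp3 : 3 < p)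
    (q : ℤ) (hq : (p : ℤ) * q = 2 ^ (p - 1) - 1)
    (g : ZMod (p ^ 2))
    (hg : g = ∑ i ∈ Finset.Icc 1 (p - 1), (-1 : ZMod (p ^ 2)) ^ i * (i : ZMod (p ^ 2))⁻¹) :
    2 * (q : ZMod (p ^ 2)) = -g + (q : ZMod (p ^ 2)) ^ 2 * (p : ZMod (p ^ 2)) := by
  have := Fact.mk hp
  have hmain := two_mul_quotient_eq hp hq
  rw [← hg] at hmain
  rw [hmain, mul_comm (_ ^ 2)]
  congr 1
  refine natCast_mul_eq_of_castHom_eq ?_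
  set φ := ZMod.castHom (dvd_pow_self p two_ne_zero) (ZMod p)
  have hinv (i : ℕ) (h1 : 1 ≤ i) (h2 : i < p) : φ (i : ZMod (p ^ 2))⁻¹ = (i : ZMod p)⁻¹ :=
    castHom_natCast_inv hp h1 h2
  have hφg : φ g = ∑ i ∈ Icc 1 (p - 1), (-1) ^ i * (i : ZMod p)⁻¹ := by
    rw [hg, map_sum]
    refine sum_congr rfl fun i hi => ?_
    rw [mem_Icc] at hi
    rw [map_mul, map_pow, map_neg, map_one, hinv i hi.1 (by omega)]
  have hφS : φ (∑ i ∈ Icc 1 (p - 1), (-1) ^ i * (i : ZMod (p ^ 2))⁻¹ *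
      ∑ j ∈ Icc 1 (i - 1), (j : ZMod (p ^ 2))⁻¹) = ∑ i ∈ Icc 1 (p - 1),
        (-1) ^ i * (i : ZMod p)⁻¹ * ∑ j ∈ Icc 1 (i - 1), (j : ZMod p)⁻¹ := by
    rw [map_sum]
    refine sum_congr rfl fun i hi => ?_
    rw [mem_Icc] at hi
    rw [map_mul, map_mul, map_pow, map_neg, map_one, hinv i hi.1 (by omega), map_sum]
    congr 1
    refine sum_congr rfl fun j hj => ?_
    rw [mem_Icc] at hj
    exact hinv j hj.1 (by omega)
  have hsq := alternating_sum_sq hp hp3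
  rw [← hφg, ← hφS] at hsq
  have hφq := congrArg φ hmain
  rw [map_mul, map_add, map_mul, map_neg, map_natCast, ZMod.natCast_self, zero_mul, add_zero,
    map_ofNat] at hφq
  have h4 : (4 : ZMod p) ≠ 0 := by
    exact_mod_cast natCast_ne_zero (p := p) (i := 4) (by norm_num)
      (lt_of_le_of_ne hp3 (by rintro rfl; norm_num at hp))
  refine mul_left_cancel₀ h4 ?_
  rw [map_pow, ← hsq]
  linear_combination (φ g - 2 * φ (q : ZMod (p ^ 2))) * hφq
end
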